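/- Let Ω be a finite set with |Ω| > 9 and let G be a solvable subgroup of the symmetric group on Ω acting primitively on Ω. Then there exists a subset Δ of Ω with 2|Δ| ≠ |Ω| whose setwise stabilizer in G is the trivial subgroup. -/

import Mathlib

open Pointwise

/-- A permutation group `(G, Ω)` is primitive if it is transitive and every block is trivial. -/
def IsPrimitivePermGroup (Ω : Type*) [Fintype Ω] (G : Subgroup (Equiv.Perm Ω)) : Prop :=
  MulAction.IsPretransitive G Ω ∧
    ∀ B : Set Ω, MulAction.IsBlock G B → MulAction.IsTrivialBlock B

/-- A permutation of an abelian group that respects the ternary operation `x - y + z`. -/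
def IsAffinePerm {V : Type*} [AddCommGroup V] (g : Equiv.Perm V) : Prop :=
  ∀ x y z, g (x - y + z) = g x - g y + g z

/-- `V` has a subset of size more than `2` and less than `|V| / 2 - 1` which is stabilized by no
nontrivial affine permutation. -/
def HasRigidSubset (V : Type*) [AddCommGroup V] : Prop :=
  ∃ Δ : Finset V, 2 < Δ.card ∧ 2 * Δ.card + 2 < Nat.card V ∧
    ∀ g : Equiv.Perm V, IsAffinePerm g → (∀ x, g x ∈ Δ ↔ x ∈ Δ) → g = 1

namespace IsAffinePerm

variable {V W : Type*} [AddCommGroup V] [AddCommGroup W] {g : Equiv.Perm V}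

theorem map_add_of_map_zero (hg : IsAffinePerm g) (h0 : g 0 = 0) (x y : V) :
    g (x + y) = g x + g y := by
  simpa [h0] using hg x 0 y

theorem conj (hg : IsAffinePerm g) (e : V ≃+ W) :
    IsAffinePerm (e.toEquiv.permCongr g) := by
  intro x y z
  simp [Equiv.permCongr_apply, hg (e.symm x) (e.symm y) (e.symm z)]

/-- The additive part of an affine permutation fixing `0`. -/
def toAddEquiv (hg : IsAffinePerm g) (h0 : g 0 = 0) : V ≃+ V :=
  { g with map_add' := hg.map_add_of_map_zero h0 }

@[simp]
theorem toAddEquiv_apply (hg : IsAffinePerm g) (h0 : g 0 = 0) (x : V) :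
    hg.toAddEquiv h0 x = g x := rfl

end IsAffinePerm

theorem HasRigidSubset.of_addEquiv {V W : Type*} [AddCommGroup V] [AddCommGroup W]
    (h : HasRigidSubset V) (e : V ≃+ W) : HasRigidSubset W := by
  obtain ⟨Δ, h1, h2, h3⟩ := h
  refine ⟨Δ.map e.toEquiv.toEmbedding, by simpa, by simpa [← Nat.card_congr e.toEquiv], ?_⟩
  intro g hg hΔ
  have key := h3 (e.symm.toEquiv.permCongr g) (hg.conj e.symm) (by
    intro x
    have := hΔ (e x)
    simp only [Finset.mem_map_equiv] at this
    simpa [Equiv.permCongr_apply] using this)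
  ext x
  have := congrArg e (Equiv.congr_fun key (e.symm x))
  simpa [Equiv.permCongr_apply] using this

theorem two_mul_card_fiber_le {V : Type*} {A : Type*} [AddCommGroup V] [AddCommGroup A]
    [Fintype V] [DecidableEq V] (f : V → A) (hf : ∀ x y z, f (x - y + z) = f x - f y + f z)
    (u w : V) (huw : f u ≠ f w) (S : Finset V) (c : A) (hS : ∀ x ∈ S, f x = c) :
    2 * S.card ≤ Fintype.card V := by
  have hd : Disjoint S (S.map (addRightEmbedding (w - u))) := by
    rw [Finset.disjoint_left]
    rintro x hx hx'
    obtain ⟨y, hy, rfl⟩ := Finset.mem_map.1 hx'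
    have h1 := hS _ hx
    have h2 := hS _ hy
    have h3 := hf y u w
    rw [addRightEmbedding_apply, show y + (w - u) = y - u + w by abel, h3, h2] at h1
    apply huw
    have : f w - f u = 0 := by
      rw [← sub_eq_zero] at h1
      rw [← h1]; abel
    exact (sub_eq_zero.1 this).symm
  have := Finset.card_le_univ (S ∪ S.map (addRightEmbedding (w - u)))
  rw [Finset.card_union_of_disjoint hd, Finset.card_map] at this
  omega

/-- Rigidity passes from a hyperplane `V` to `V × ℤ/p`, using the complement of the rigid set in
the hyperplane together with one point outside. -/
theorem HasRigidSubset.prod {V : Type*} [AddCommGroup V] [Finite V] (p : ℕ) [Fact p.Prime]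
    (h : HasRigidSubset V) : HasRigidSubset (V × ZMod p) := by
  classical
  have := Fintype.ofFinite V
  obtain ⟨Δ, h1, h2, h3⟩ := h
  rw [Nat.card_eq_fintype_card] at h2
  have hp : 2 ≤ p := (Fact.out : p.Prime).two_le
  set P : Finset V := Δᶜ with hP
  have hPc : P.card + Δ.card = Fintype.card V := by
    rw [hP, Finset.card_compl]; have := Finset.card_le_univ Δ; omega
  let i : V ↪ V × ZMod p := ⟨fun x => (x, 0), fun x y h => congrArg Prod.fst h⟩
  have hi : ∀ x, i x = (x, 0) := fun _ => rfl
  have hw : ((0, 1) : V × ZMod p) ∉ P.map i := by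
    simp [hi]
  set D : Finset (V × ZMod p) := insert (0, 1) (P.map i) with hD
  have hDc : D.card = P.card + 1 := by
    rw [hD, Finset.card_insert_of_notMem hw, Finset.card_map]
  have hmem : ∀ x : V, (x, (0 : ZMod p)) ∈ D ↔ x ∉ Δ := by
    intro x; simp [hD, hi, hP]
  have hout : ∀ y ∈ D, y.2 ≠ 0 → y = (0, 1) := by
    intro y hy h0
    rcases Finset.mem_insert.1 hy with h | h
    · exact h
    · obtain ⟨x, -, rfl⟩ := Finset.mem_map.1 h
      exact absurd rfl h0
  refine ⟨D, by omega, ?_, ?_⟩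
  · rw [Nat.card_prod, Nat.card_eq_fintype_card, Nat.card_zmod, hDc]
    nlinarith
  intro g hg hΔ
  have hgW : ∀ x : V, (g (x, 0)).2 = 0 := by
    by_contra! hne
    obtain ⟨x0, hx0⟩ := hne
    -- points of `P` sent outside the hyperplane
    have hone : (P.filter fun x => (g (x, 0)).2 ≠ 0).card ≤ 1 := by
      rw [Finset.card_le_one]
      intro a ha b hb
      simp only [Finset.mem_filter] at ha hb
      have ha' := hout _ ((hΔ _).2 ((hmem a).2 (by simpa [hP] using ha.1))) ha.2
      have hb' := hout _ ((hΔ _).2 ((hmem b).2 (by simpa [hP] using hb.1))) hb.2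
      exact congrArg Prod.fst (g.injective (ha'.trans hb'.symm))
    have hsum := Finset.card_filter_add_card_filter_not (s := P) (fun x => (g (x, 0)).2 = 0)
    by_cases hc : ∃ u, (g (u, 0)).2 = 0
    · obtain ⟨u, hu⟩ := hc
      have := two_mul_card_fiber_le (fun x : V => (g (x, 0)).2) (fun x y z => by
        have := congrArg Prod.snd (hg (x, 0) (y, 0) (z, 0))
        simpa using this) x0 u (by simpa [hu] using hx0)
        (P.filter fun x => (g (x, 0)).2 = 0) 0 (by simp)
      simp only [ne_eq] at hone
      omega
    · push Not at hc
      rw [Finset.filter_false_of_mem (s := P) (p := fun x => (g (x, 0)).2 = 0)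
        (fun x _ => hc x)] at hsum
      simp only [Finset.card_empty, ne_eq] at hsum hone
      omega
  have hinj : Function.Injective fun x : V => (g (x, 0)).1 := by
    intro x y hxy
    have : g (x, 0) = g (y, 0) := Prod.ext hxy ((hgW x).trans (hgW y).symm)
    exact congrArg Prod.fst (g.injective this)
  have hg' := h3 (Equiv.ofBijective _ (Finite.injective_iff_bijective.1 hinj))
    (fun x y z => by
      have := congrArg Prod.fst (hg (x, 0) (y, 0) (z, 0))
      simpa using this)
    (fun x => by
      rw [← not_iff_not, Equiv.ofBijective_apply, ← hmem, ← hmem x, ← hΔ (x, 0)]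
      have : ((g (x, 0)).1, (0 : ZMod p)) = g (x, 0) := Prod.ext rfl (hgW x).symm
      rw [this])
  have hfix : ∀ x : V, g (x, 0) = (x, 0) := fun x =>
    Prod.ext (Equiv.congr_fun hg' x) (hgW x)
  have hw1 : g (0, 1) = (0, 1) := by
    refine hout _ ((hΔ _).2 (by simp [hD])) fun h0 => ?_
    have : g (0, 1) = g ((g (0, 1)).1, 0) := by
      rw [hfix]; exact Prod.ext rfl h0
    have := congrArg Prod.snd (g.injective this)
    exact one_ne_zero this
  let L : V × ZMod p →+ V × ZMod p := (hg.toAddEquiv (hfix 0)).toAddMonoidHom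
  have hLg : ∀ x, L x = g x := fun x => rfl
  ext1 ⟨x, t⟩
  have hxt : ((x, t) : V × ZMod p) = (x, 0) + t.val • (0, 1) := by
    ext <;> simp
  rw [← hLg, hxt, map_add, map_nsmul, hLg, hLg, hw1, hfix]
  rfl

/-- The number of ways to write an element of `Δ` as `a - b + x` with `a, b ∈ Δ`. -/
def tripleCount {V : Type*} [AddCommGroup V] [DecidableEq V] (Δ : Finset V) (x : V) : ℕ :=
  ((Δ ×ˢ Δ).filter fun q => q.1 - q.2 + x ∈ Δ).card

theorem IsAffinePerm.tripleCount_apply {V : Type*} [AddCommGroup V] [DecidableEq V]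
    {g : Equiv.Perm V} (hg : IsAffinePerm g) {Δ : Finset V} (hΔ : ∀ x, g x ∈ Δ ↔ x ∈ Δ) (x : V) :
    tripleCount Δ (g x) = tripleCount Δ x := by
  symm
  apply Finset.card_bij (fun q _ => (g q.1, g q.2))
  · rintro ⟨a, b⟩ h
    simpa [hΔ, ← hg a b x] using h
  · rintro ⟨a, b⟩ - ⟨c, d⟩ - h
    simpa using h
  · rintro ⟨a, b⟩ h
    refine ⟨(g.symm a, g.symm b), ?_, by simp⟩
    have ha := hΔ (g.symm a)
    have hb := hΔ (g.symm b)
    have hx := hΔ (g.symm a - g.symm b + x)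
    rw [hg] at hx
    simp only [Equiv.apply_symm_apply] at ha hb hx
    simpa [← ha, ← hb, ← hx] using h

theorem IsAffinePerm.eq_one_of_basis {n p : ℕ} [NeZero p] {g : Equiv.Perm (Fin n → ZMod p)}
    (hg : IsAffinePerm g) (h0 : g 0 = 0) (h1 : ∀ i, g (Pi.single i 1) = Pi.single i 1) :
    g = 1 := by
  let L : (Fin n → ZMod p) →+ (Fin n → ZMod p) := (hg.toAddEquiv h0).toAddMonoidHom
  have key : L = AddMonoidHom.id _ := by
    apply AddMonoidHom.functions_ext'
    intro i
    ext1 t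
    have : Pi.single i t = t.val • (Pi.single i 1 : Fin n → ZMod p) := by
      rw [← Pi.single_smul]; simp
    simp only [AddMonoidHom.comp_apply, AddMonoidHom.single_apply, AddMonoidHom.id_apply]
    rw [this, map_nsmul]
    exact congrArg _ (h1 i)
  ext1 x
  exact DFunLike.congr_fun key x

/-- A criterion for rigidity: `0` and the basis vectors lie in `Δ` and are separated from the other
points of `Δ` by `tripleCount`. -/
theorem HasRigidSubset.of_tripleCount {n p : ℕ} [NeZero p] (Δ : Finset (Fin n → ZMod p))
    (h2 : 2 < Δ.card) (hlt : 2 * Δ.card + 2 < p ^ n)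
    (h0 : 0 ∈ Δ ∧ ∀ y ∈ Δ, tripleCount Δ y = tripleCount Δ 0 → y = 0)
    (h1 : ∀ i, Pi.single i 1 ∈ Δ ∧
      ∀ y ∈ Δ, tripleCount Δ y = tripleCount Δ (Pi.single i 1) → y = Pi.single i 1) :
    HasRigidSubset (Fin n → ZMod p) := by
  refine ⟨Δ, h2, by simpa [Nat.card_pi] using hlt, fun g hg hΔ => ?_⟩
  have key : ∀ s ∈ Δ, (∀ y ∈ Δ, tripleCount Δ y = tripleCount Δ s → y = s) → g s = s :=
    fun s hs h => h _ ((hΔ s).2 hs) (hg.tripleCount_apply hΔ s)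
  exact hg.eq_one_of_basis (key _ h0.1 h0.2) fun i => key _ (h1 i).1 (h1 i).2

theorem hasRigidSubset_seven : HasRigidSubset (Fin 2 → ZMod 7) :=
  .of_tripleCount {![0, 0], ![1, 0], ![0, 1], ![1, 4], ![3, 1], ![4, 4]}
    (by decide +kernel) (by decide +kernel) (by decide +kernel) (by decide +kernel)

theorem hasRigidSubset_five : HasRigidSubset (Fin 2 → ZMod 5) :=
  .of_tripleCount {![0, 0], ![1, 0], ![0, 1], ![1, 3], ![0, 2], ![2, 3]}
    (by decide +kernel) (by decide +kernel) (by decide +kernel) (by decide +kernel)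

theorem hasRigidSubset_three : HasRigidSubset (Fin 3 → ZMod 3) :=
  .of_tripleCount {![0, 0, 0], ![1, 0, 0], ![0, 1, 0], ![0, 0, 1], ![1, 0, 1], ![1, 1, 2],
    ![2, 2, 2], ![0, 2, 1], ![2, 1, 1], ![0, 0, 2]}
    (by decide +kernel) (by decide +kernel) (by decide +kernel) (by decide +kernel)

/-- The vector of the first `n` binary digits of a natural number. -/
def bitVector (n m : ℕ) : Fin n → ZMod 2 := fun i => if m.testBit i then 1 else 0

theorem bitVector_sub_add (n a b c : ℕ) :
    bitVector n a - bitVector n b + bitVector n c = bitVector n (a ^^^ b ^^^ c) := by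
  ext i
  simp only [bitVector, Pi.add_apply, Pi.sub_apply, Nat.testBit_xor]
  cases a.testBit i <;> cases b.testBit i <;> cases c.testBit i <;> decide

theorem bitVector_injOn (n : ℕ) : Set.InjOn (bitVector n) {m | m < 2 ^ n} := by
  intro a ha b hb hab
  refine Nat.eq_of_testBit_eq fun i => ?_
  by_cases hi : i < n
  · have := congrFun hab ⟨i, hi⟩
    simp only [bitVector] at this
    cases h1 : a.testBit i <;> cases h2 : b.testBit i <;> simp_all
  · have hn : 2 ^ n ≤ 2 ^ i := Nat.pow_le_pow_right (by norm_num) (by omega)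
    rw [Nat.testBit_lt_two_pow (lt_of_lt_of_le ha hn),
      Nat.testBit_lt_two_pow (lt_of_lt_of_le hb hn)]

theorem bitVector_zero (n : ℕ) : bitVector n 0 = 0 := by
  ext i; simp [bitVector]

theorem bitVector_two_pow (n : ℕ) (i : Fin n) : bitVector n (2 ^ (i : ℕ)) = Pi.single i 1 := by
  ext j
  simp only [bitVector, Nat.testBit_two_pow, decide_eq_true_eq, Pi.single_apply, Fin.ext_iff]
  simp only [eq_comm]

theorem tripleCount_image_bitVector {n : ℕ} (L : Finset ℕ) (hL : ∀ m ∈ L, m < 2 ^ n)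
    {x : ℕ} (hx : x < 2 ^ n) : tripleCount (L.image (bitVector n)) (bitVector n x) =
      ((L ×ˢ L).filter fun q => q.1 ^^^ q.2 ^^^ x ∈ L).card := by
  have hmem : ∀ m < 2 ^ n, bitVector n m ∈ L.image (bitVector n) ↔ m ∈ L := fun m hm => by
    rw [Finset.mem_image]
    refine ⟨?_, fun h => ⟨m, h, rfl⟩⟩
    rintro ⟨a, ha, h⟩
    exact bitVector_injOn n (hL a ha) hm h ▸ ha
  symm
  apply Finset.card_bij fun q _ => (bitVector n q.1, bitVector n q.2)
  · rintro ⟨a, b⟩ h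
    simp only [Finset.mem_filter, Finset.mem_product] at h ⊢
    rw [bitVector_sub_add]
    exact ⟨⟨Finset.mem_image_of_mem _ h.1.1, Finset.mem_image_of_mem _ h.1.2⟩,
      Finset.mem_image_of_mem _ h.2⟩
  · rintro ⟨a, b⟩ h ⟨c, d⟩ h' heq
    simp only [Finset.mem_filter, Finset.mem_product, Prod.mk.injEq] at h h' heq
    rw [bitVector_injOn n (hL a h.1.1) (hL c h'.1.1) heq.1,
      bitVector_injOn n (hL b h.1.2) (hL d h'.1.2) heq.2]
  · rintro ⟨u, v⟩ h
    simp only [Finset.mem_filter, Finset.mem_product] at h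
    obtain ⟨⟨hu, hv⟩, h⟩ := h
    obtain ⟨a, ha, rfl⟩ := Finset.mem_image.1 hu
    obtain ⟨b, hb, rfl⟩ := Finset.mem_image.1 hv
    rw [bitVector_sub_add, hmem _ (Nat.xor_lt_two_pow (Nat.xor_lt_two_pow (hL a ha) (hL b hb)) hx)]
      at h
    exact ⟨(a, b), by simp [ha, hb, h], rfl⟩

theorem HasRigidSubset.of_bitVector {n : ℕ} (L : Finset ℕ) (hL : ∀ m ∈ L, m < 2 ^ n)
    (h2 : 2 < L.card) (hlt : 2 * L.card + 2 < 2 ^ n)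
    (h0 : ∀ s ∈ insert 0 ((Finset.range n).image fun i => 2 ^ i), s ∈ L ∧ ∀ y ∈ L,
      ((L ×ˢ L).filter fun q => q.1 ^^^ q.2 ^^^ y ∈ L).card =
        ((L ×ˢ L).filter fun q => q.1 ^^^ q.2 ^^^ s ∈ L).card → y = s) :
    HasRigidSubset (Fin n → ZMod 2) := by
  have hc : (L.image (bitVector n)).card = L.card :=
    Finset.card_image_of_injOn ((bitVector_injOn n).mono hL)
  have key : ∀ s ∈ insert 0 ((Finset.range n).image fun i => 2 ^ i),
      bitVector n s ∈ L.image (bitVector n) ∧ ∀ y ∈ L.image (bitVector n),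
        tripleCount (L.image (bitVector n)) y =
          tripleCount (L.image (bitVector n)) (bitVector n s) → y = bitVector n s := by
    intro s hs
    obtain ⟨hsL, hy⟩ := h0 s hs
    refine ⟨Finset.mem_image_of_mem _ hsL, fun y hyL h => ?_⟩
    obtain ⟨m, hm, rfl⟩ := Finset.mem_image.1 hyL
    rw [tripleCount_image_bitVector L hL (hL m hm),
      tripleCount_image_bitVector L hL (hL s hsL)] at h
    rw [hy m hm h]
  refine .of_tripleCount (L.image (bitVector n)) (by omega) (by omega) ?_ fun i => ?_
  · simpa [bitVector_zero] using key 0 (by simp)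
  · simpa [bitVector_two_pow] using key (2 ^ (i : ℕ)) (by
      simp only [Finset.mem_insert, Finset.mem_image, Finset.mem_range]
      exact Or.inr ⟨i, i.2, rfl⟩)

theorem hasRigidSubset_two : HasRigidSubset (Fin 6 → ZMod 2) :=
  .of_bitVector {0, 1, 2, 4, 8, 16, 32, 3, 7, 11, 21, 15, 43, 57, 58, 47, 62}
    (by decide +kernel) (by decide +kernel) (by decide +kernel) (by decide +kernel)

theorem hasRigidSubset_of_eleven_le {p : ℕ} [Fact p.Prime] (hp : 11 ≤ p) :
    HasRigidSubset (ZMod p) := by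
  have hne : ∀ k : ℕ, 0 < k → k < 11 → (k : ZMod p) ≠ 0 := fun k h0 hk h => by
    have := Nat.le_of_dvd h0 ((ZMod.natCast_eq_zero_iff _ _).1 h)
    omega
  have h1 := hne 1 (by norm_num) (by norm_num)
  have h2 := hne 2 (by norm_num) (by norm_num)
  have h3 := hne 3 (by norm_num) (by norm_num)
  have h4 := hne 4 (by norm_num) (by norm_num)
  have h5 := hne 5 (by norm_num) (by norm_num)
  have h6 := hne 6 (by norm_num) (by norm_num)
  have h7 := hne 7 (by norm_num) (by norm_num)
  have h8 := hne 8 (by norm_num) (by norm_num)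
  have h9 := hne 9 (by norm_num) (by norm_num)
  push_cast at h1 h2 h3 h4 h5 h6 h7 h8 h9
  have hc : ({0, 1, 3} : Finset (ZMod p)).card = 3 := by
    rw [Finset.card_insert_of_notMem, Finset.card_pair]
    · intro h; apply h2; linear_combination -h
    · simp only [Finset.mem_insert, Finset.mem_singleton, not_or]
      exact ⟨fun h => h1 h.symm, fun h => h3 h.symm⟩
  refine ⟨{0, 1, 3}, by omega, by rw [hc, Nat.card_zmod]; omega, fun g hg hΔ => ?_⟩
  have h01 : g 0 ≠ g 1 := fun h => zero_ne_one (g.injective h)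
  have key : ∀ t : ZMod p, g t = (g 1 - g 0) * t + g 0 := by
    intro t
    have : ∀ n : ℕ, g (n : ZMod p) = (g 1 - g 0) * n + g 0 := by
      intro n
      induction n with
      | zero => simp
      | succ n ih =>
        have := hg n 0 1
        rw [sub_zero] at this
        push_cast
        rw [this, ih]; ring
    simpa using this t.val
  have m0 := (hΔ 0).2 (by simp)
  have m1 := (hΔ 1).2 (by simp)
  have m3 := (hΔ 3).2 (by simp)
  rw [key 3] at m3
  simp only [Finset.mem_insert, Finset.mem_singleton] at m0 m1 m3
  have hid : g 0 = 0 → g 1 = 1 → g = 1 := fun a b => by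
    ext1 t
    rw [key, a, b]; simp
  rcases m0 with a | a | a <;> rcases m1 with b | b | b <;> rw [a, b] at m3 h01
  all_goals first | exact absurd rfl h01 | exact hid a b | skip
  all_goals exfalso; rcases m3 with c | c | c
  all_goals first
    | exact h1 (by linear_combination c) | exact h1 (by linear_combination -c)
    | exact h2 (by linear_combination c) | exact h2 (by linear_combination -c)
    | exact h3 (by linear_combination c) | exact h3 (by linear_combination -c)
    | exact h4 (by linear_combination c) | exact h4 (by linear_combination -c)
    | exact h5 (by linear_combination c) | exact h5 (by linear_combination -c)
    | exact h6 (by linear_combination c) | exact h6 (by linear_combination -c)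
    | exact h7 (by linear_combination c) | exact h7 (by linear_combination -c)
    | exact h8 (by linear_combination c) | exact h9 (by linear_combination c)
    | exact h9 (by linear_combination -c)

theorem exists_normal_elementary_abelian (G : Type*) [Group G] [Finite G] [Nontrivial G]
    [Group.IsSolvable G] : ∃ p : ℕ, p.Prime ∧ ∃ M : Subgroup G, M.Normal ∧ M ≠ ⊥ ∧
      (∀ x ∈ M, ∀ y ∈ M, x * y = y * x) ∧ ∀ x ∈ M, x ^ p = 1 := by
  classical
  have hex : ∃ n, derivedSeries G n = ⊥ := Group.IsSolvable.solvable
  obtain ⟨n, hn⟩ : ∃ n, Nat.find hex = n + 1 := by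
    refine Nat.exists_eq_succ_of_ne_zero fun h => ?_
    have := Nat.find_spec hex
    rw [h, derivedSeries_zero] at this
    exact top_ne_bot this
  have hD1 : derivedSeries G n ≠ ⊥ := Nat.find_min hex (by omega)
  have hD2 : derivedSeries G (n + 1) = ⊥ := hn ▸ Nat.find_spec hex
  set D := derivedSeries G n with hD
  have hDn : D.Normal := derivedSeries_normal G n
  rw [derivedSeries_succ, Subgroup.commutator_eq_bot_iff_le_centralizer] at hD2
  have hcomm : ∀ x ∈ D, ∀ y ∈ D, x * y = y * x := fun x hx y hy =>
    (Subgroup.mem_centralizer_iff.1 (hD2 hx) y hy).symm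
  have hcard : Nat.card D ≠ 1 := fun h => hD1 (Subgroup.card_eq_one.1 h)
  obtain ⟨p, hp, hpD⟩ := Nat.exists_prime_and_dvd hcard
  have : Fact p.Prime := ⟨hp⟩
  obtain ⟨⟨x, hx⟩, hxp⟩ := exists_prime_orderOf_dvd_card' p hpD
  rw [Subgroup.orderOf_mk] at hxp
  let M : Subgroup G :=
    { carrier := {x | x ∈ D ∧ x ^ p = 1}
      one_mem' := ⟨D.one_mem, one_pow _⟩
      mul_mem' := fun {a b} ha hb => ⟨D.mul_mem ha.1 hb.1, by
        rw [(show Commute a b from hcomm a ha.1 b hb.1).mul_pow, ha.2, hb.2, one_mul]⟩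
      inv_mem' := fun {a} ha => ⟨D.inv_mem ha.1, by rw [inv_pow, ha.2, inv_one]⟩ }
  refine ⟨p, hp, M, ⟨fun m hm g => ⟨hDn.conj_mem m hm.1 g, ?_⟩⟩, fun h => ?_,
    fun x hx y hy => hcomm x hx.1 y hy.1, fun x hx => hx.2⟩
  · rw [conj_pow, hm.2, mul_one, mul_inv_cancel]
  · have hxM : x ∈ M := ⟨hx, by rw [← hxp, pow_orderOf_eq_one]⟩
    rw [h, Subgroup.mem_bot] at hxM
    rw [hxM, orderOf_one] at hxp
    exact hp.one_lt.ne hxp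

theorem Subgroup.exists_normal_elementary_abelian {P : Type*} [Group P] (H : Subgroup P) [Finite H]
    [Group.IsSolvable H] (hH : H ≠ ⊥) : ∃ p : ℕ, p.Prime ∧ ∃ M ≤ H, M ≠ ⊥ ∧
      (∀ h ∈ H, ∀ m ∈ M, h * m * h⁻¹ ∈ M) ∧
      (∀ x ∈ M, ∀ y ∈ M, x * y = y * x) ∧ ∀ x ∈ M, x ^ p = 1 := by
  have : Nontrivial H := (Subgroup.nontrivial_iff_ne_bot H).2 hH
  obtain ⟨p, hp, M, hM1, hM2, hM3, hM4⟩ := _root_.exists_normal_elementary_abelian H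
  refine ⟨p, hp, M.map H.subtype, Subgroup.map_subtype_le M, fun h => hM2 ?_, ?_, ?_, ?_⟩
  · rwa [Subgroup.map_eq_bot_iff_of_injective _ H.subtype_injective] at h
  · rintro h hh _ ⟨m, hm, rfl⟩
    exact ⟨⟨h, hh⟩ * m * ⟨h, hh⟩⁻¹, hM1.conj_mem m hm _, rfl⟩
  · rintro _ ⟨x, hx, rfl⟩ _ ⟨y, hy, rfl⟩
    exact congrArg H.subtype (hM3 x hx y hy)
  · rintro _ ⟨x, hx, rfl⟩
    exact congrArg H.subtype (hM4 x hx)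

theorem exists_regular_normal_subgroup {Ω : Type*} [Finite Ω] [Nontrivial Ω]
    (G : Subgroup (Equiv.Perm Ω)) [Group.IsSolvable G] [MulAction.IsPreprimitive G Ω] :
    ∃ p : ℕ, p.Prime ∧ ∃ M ≤ G, (∀ g ∈ G, ∀ m ∈ M, g * m * g⁻¹ ∈ M) ∧
      (∀ x ∈ M, ∀ y ∈ M, x * y = y * x) ∧ (∀ x ∈ M, x ^ p = 1) ∧
      (∀ x y, ∃ m ∈ M, m x = y) ∧ ∀ m ∈ M, ∀ x, m x = x → m = 1 := by
  have hG : G ≠ ⊥ := by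
    rintro rfl
    obtain ⟨x, y, hxy⟩ := exists_pair_ne Ω
    obtain ⟨⟨g, hg⟩, hgx⟩ := MulAction.exists_smul_eq (⊥ : Subgroup (Equiv.Perm Ω)) x y
    rw [Subgroup.mem_bot] at hg
    subst hg
    exact hxy hgx
  have : Nontrivial G := (Subgroup.nontrivial_iff_ne_bot G).2 hG
  obtain ⟨p, hp, M, hM1, hM2, hM3, hM4⟩ := exists_normal_elementary_abelian G
  have htr : MulAction.IsPretransitive M Ω := by
    refine MulAction.IsQuasiPreprimitive.isPretransitive_of_normal (G := G) fun h => hM2 ?_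
    rw [eq_bot_iff]
    intro m hm
    rw [Subgroup.mem_bot]
    ext x
    have hx : x ∈ MulAction.fixedPoints M Ω := by rw [h]; trivial
    exact hx ⟨m, hm⟩
  have htr' : ∀ x y, ∃ m ∈ M, (m : Equiv.Perm Ω) x = y := fun x y => by
    obtain ⟨m, hm⟩ := MulAction.exists_smul_eq M x y
    exact ⟨m, m.2, hm⟩
  refine ⟨p, hp, M.map G.subtype, Subgroup.map_subtype_le M, ?_, ?_, ?_, ?_, ?_⟩
  · rintro h hh _ ⟨m, hm, rfl⟩
    exact ⟨⟨h, hh⟩ * m * ⟨h, hh⟩⁻¹, hM1.conj_mem m hm _, rfl⟩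
  · rintro _ ⟨x, hx, rfl⟩ _ ⟨y, hy, rfl⟩
    exact congrArg G.subtype (hM3 x hx y hy)
  · rintro _ ⟨x, hx, rfl⟩
    exact congrArg G.subtype (hM4 x hx)
  · intro x y
    obtain ⟨m, hm, h⟩ := htr' x y
    exact ⟨m, ⟨m, hm, rfl⟩, h⟩
  · rintro _ ⟨m, hm, rfl⟩ x hx
    ext y
    obtain ⟨k, hk, rfl⟩ := htr' x y
    have := congrArg G.subtype (hM3 m hm k hk)
    have := Equiv.congr_fun this x
    simp only [Subgroup.subtype_apply, Subgroup.coe_mul, Equiv.Perm.mul_apply] at this hx ⊢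
    rw [this, hx, Equiv.Perm.one_apply]

theorem exists_affine_structure.{u} {Ω : Type u} [Finite Ω] [Nontrivial Ω]
    (G : Subgroup (Equiv.Perm Ω)) [Group.IsSolvable G] [MulAction.IsPreprimitive G Ω] :
    ∃ p : ℕ, p.Prime ∧ ∃ V : Type u, ∃ _ : AddCommGroup V,
      ∃ e : V ≃ Ω, (∀ v : V, p • v = 0) ∧
      (∀ g ∈ G, IsAffinePerm (e.symm.permCongr g)) ∧
      ∀ v, e.permCongr (Equiv.addRight v) ∈ G := by
  obtain ⟨p, hp, M, hMG, hMn, hMc, hMp, hMt, hMf⟩ := exists_regular_normal_subgroup G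
  let _ : CommGroup M := { (inferInstance : Group M) with
    mul_comm := fun x y => Subtype.ext (hMc x x.2 y y.2) }
  obtain ⟨o⟩ : Nonempty Ω := inferInstance
  have hbij : Function.Bijective fun m : Additive M => (m.toMul : Equiv.Perm Ω) o := by
    refine ⟨fun x y hxy => ?_, fun y => ?_⟩
    · have h := hMf _ (y.toMul⁻¹ * x.toMul).2 o (by
        simpa [Equiv.symm_apply_eq] using hxy)
      exact (inv_mul_eq_one.1 (Subtype.ext h : y.toMul⁻¹ * x.toMul = 1)).symm
    · obtain ⟨m, hm, h⟩ := hMt o y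
      exact ⟨Additive.ofMul ⟨m, hm⟩, h⟩
  let e : Additive M ≃ Ω := Equiv.ofBijective _ hbij
  have he : ∀ m : Additive M, e m = (m.toMul : Equiv.Perm Ω) o := fun m => rfl
  refine ⟨p, hp, Additive M, inferInstance, e, fun v => ?_, fun g hg => ?_, fun v => ?_⟩
  · exact Additive.toMul.injective (Subtype.ext (hMp _ v.toMul.2))
  · let φ : M →* M :=
      { toFun := fun m => ⟨g * m * g⁻¹, hMn g hg m m.2⟩
        map_one' := Subtype.ext (by simp)
        map_mul' := fun x y => Subtype.ext (by simp [mul_assoc]) }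
    have key : ∀ v, e.symm.permCongr g v = φ.toAdditive v + e.symm (g o) := by
      intro v
      rw [Equiv.permCongr_apply, Equiv.symm_symm, Equiv.symm_apply_eq, he, he]
      have h : (((e.symm (g o)).toMul : M) : Equiv.Perm Ω) o = g o := by
        rw [← he, Equiv.apply_symm_apply]
      simp [φ, h]
    intro x y z
    rw [key, key, key, key, map_add, map_sub]
    abel
  · have : e.permCongr (Equiv.addRight v) = v.toMul := by
      ext x
      obtain ⟨w, rfl⟩ := e.surjective x
      rw [Equiv.permCongr_apply, Equiv.symm_apply_apply]
      change e (w + v) = _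
      rw [add_comm, he, he]
      simp
    rw [this]
    exact hMG v.toMul.2

/-- A solvable irreducible group of affine permutations of `V` containing all translations. -/
structure IsSolvableAffine {V : Type*} [AddCommGroup V] (G : Subgroup (Equiv.Perm V)) : Prop where
  isSolvable : Group.IsSolvable G
  isAffine : ∀ g ∈ G, IsAffinePerm g
  addRight_mem : ∀ v, Equiv.addRight v ∈ G
  irreducible : ∀ W : AddSubgroup V, (∀ g ∈ G, g 0 = 0 → ∀ w ∈ W, g w ∈ W) → W = ⊥ ∨ W = ⊤

theorem isSolvableAffine_map {Ω V : Type*} [Finite Ω] [AddCommGroup V]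
    (G : Subgroup (Equiv.Perm Ω)) [hs : Group.IsSolvable G] [MulAction.IsPreprimitive G Ω]
    (e : V ≃ Ω) (haff : ∀ g ∈ G, IsAffinePerm (e.symm.permCongr g))
    (htr : ∀ v, e.permCongr (Equiv.addRight v) ∈ G) :
    IsSolvableAffine (G.map e.symm.permCongrHom.toMonoidHom) where
  isSolvable := Group.isSolvable_of_surjective
    (f := (e.symm.permCongrHom.toMonoidHom.subgroupMap G))
    (MonoidHom.subgroupMap_surjective _ G)
  isAffine := by
    rintro _ ⟨g, hg, rfl⟩
    exact haff g hg
  addRight_mem v := ⟨_, htr v, by ext x; simp⟩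
  irreducible W hW := by
    have : Finite V := Finite.of_equiv _ e.symm
    have hB : MulAction.IsBlock G (e '' (W : Set V)) := by
      rw [MulAction.isBlock_iff_smul_eq_of_nonempty]
      rintro ⟨g, hg⟩ ⟨_, ⟨_, ⟨w, hw, rfl⟩, rfl⟩, ⟨w', hw', hww⟩⟩
      set c := e.symm (g (e 0)) with hc
      have hW' : ∀ u ∈ W, e.symm (g (e u)) - c ∈ W := by
        intro u hu
        have := hW (Equiv.addRight (-c) * e.symm.permCongr g)
          (Subgroup.mul_mem _ ⟨_, htr (-c), by ext x; simp⟩ ⟨g, hg, rfl⟩) (by simp [hc]) u hu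
        simpa [sub_eq_add_neg] using this
      have hcW : c ∈ W := by
        have h1 := hW' w hw
        have h2 : e.symm (g (e w)) = w' := by rw [Equiv.symm_apply_eq, hww]; rfl
        rw [h2] at h1
        simpa using W.sub_mem hw' h1
      refine Set.eq_of_subset_of_ncard_le ?_ (by rw [Set.ncard_smul_set]) (Set.toFinite _)
      rintro _ ⟨_, ⟨u, hu, rfl⟩, rfl⟩
      refine ⟨e.symm (g (e u)), ?_, by simp [Subgroup.smul_def]⟩
      simpa using W.add_mem (hW' u hu) hcW
    rcases MulAction.IsPreprimitive.isTrivialBlock_of_isBlock hB with h | h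
    · left
      rw [eq_bot_iff]
      intro w hw
      exact e.injective (h ⟨w, hw, rfl⟩ ⟨0, W.zero_mem, rfl⟩)
    · right
      rw [eq_top_iff]
      intro w _
      obtain ⟨u, hu, huw⟩ := h.symm ▸ Set.mem_univ (e w)
      exact e.injective huw ▸ hu

/-- The additive permutations of an abelian group. -/
def additivePerm (V : Type*) [AddCommGroup V] : Subgroup (Equiv.Perm V) where
  carrier := {h | ∀ x y, h (x + y) = h x + h y}
  one_mem' _ _ := rfl
  mul_mem' {a b} ha hb x y := by
    rw [Equiv.Perm.mul_apply, hb, ha]; rfl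
  inv_mem' {a} ha x y := by
    rw [Equiv.Perm.inv_eq_iff_eq, ha]
    simp

section AdditivePerm

variable {V : Type*} [AddCommGroup V] {h : Equiv.Perm V}

theorem map_add_of_mem (hh : h ∈ additivePerm V) (x y : V) : h (x + y) = h x + h y := hh x y

/-- An additive permutation as an additive homomorphism. -/
def additivePermHom (hh : h ∈ additivePerm V) : V →+ V := AddMonoidHom.mk' h hh

theorem map_zero_of_mem (hh : h ∈ additivePerm V) : h 0 = 0 := map_zero (additivePermHom hh)

theorem map_neg_of_mem (hh : h ∈ additivePerm V) (x : V) : h (-x) = -h x :=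
  map_neg (additivePermHom hh) x

/-- The subgroup of vectors fixed by a group of additive permutations. -/
def fixedAddSubgroup (A : Subgroup (Equiv.Perm V)) (hA : A ≤ additivePerm V) : AddSubgroup V where
  carrier := {v | ∀ a ∈ A, a v = v}
  zero_mem' a ha := map_zero_of_mem (hA ha)
  add_mem' {x y} hx hy a ha := by rw [map_add_of_mem (hA ha), hx a ha, hy a ha]
  neg_mem' {x} hx a ha := by rw [map_neg_of_mem (hA ha), hx a ha]

theorem mem_fixedAddSubgroup_zpowers {a : Equiv.Perm V}
    (ha : Subgroup.zpowers a ≤ additivePerm V) {v : V} :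
    v ∈ fixedAddSubgroup (Subgroup.zpowers a) ha ↔ a v = v := by
  refine ⟨fun h => h a (Subgroup.mem_zpowers a), ?_⟩
  rintro h _ ⟨n, rfl⟩
  exact Function.IsFixedPt.perm_zpow (e := a) h n

variable [Finite V]

theorem card_modEq_card_inf_fixedAddSubgroup {A : Subgroup (Equiv.Perm V)}
    (hA : A ≤ additivePerm V) {q : ℕ} [Fact q.Prime] (hq : ∀ a ∈ A, a ^ q = 1) (W : AddSubgroup V)
    (hW : ∀ a ∈ A, ∀ w ∈ W, a w ∈ W) :
    Nat.card W ≡ Nat.card (W ⊓ fixedAddSubgroup A hA : AddSubgroup V) [MOD q] := by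
  have hp : IsPGroup q A := fun a => ⟨1, by rw [pow_one]; exact Subtype.ext (hq a a.2)⟩
  let S : SubMulAction A V := ⟨W, fun a {w} hw => hW a a.2 w hw⟩
  refine (hp.card_modEq_card_fixedPoints S).trans (congrArg (· % q) (Nat.card_congr ?_))
  exact
    { toFun := fun x => ⟨x.1, x.1.2, fun a ha => congrArg Subtype.val (x.2 ⟨a, ha⟩)⟩
      invFun := fun x => ⟨⟨x.1, x.2.1⟩, fun a => Subtype.ext (x.2.2 a a.2)⟩
      left_inv := fun _ => rfl
      right_inv := fun _ => rfl }

theorem card_modEq_card_fixedAddSubgroup {A : Subgroup (Equiv.Perm V)}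
    (hA : A ≤ additivePerm V) {q : ℕ} [Fact q.Prime] (hq : ∀ a ∈ A, a ^ q = 1) :
    Nat.card V ≡ Nat.card (fixedAddSubgroup A hA) [MOD q] := by
  have := card_modEq_card_inf_fixedAddSubgroup hA hq ⊤ fun _ _ _ _ => trivial
  rwa [top_inf_eq, AddSubgroup.card_top] at this

theorem card_dvd_of_free {A : Subgroup (Equiv.Perm V)} (hA : A ≤ additivePerm V)
    (hfree : ∀ a ∈ A, ∀ v, v ≠ 0 → a v = v → a = 1) : Nat.card A ∣ Nat.card V - 1 := by
  let S : SubMulAction A V := ⟨{v | v ≠ 0}, fun a {w} hw h => hw <|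
    (a : Equiv.Perm V).injective (h.trans (map_zero_of_mem (hA a.2)).symm)⟩
  have h1 : ∀ v : S, MulAction.stabilizer A v = ⊥ := by
    intro v
    rw [eq_bot_iff]
    intro a ha
    exact Subtype.ext (hfree a a.2 v v.2 (congrArg Subtype.val ha))
  have h2 : Nat.card S = Nat.card V - 1 := by
    have : Nat.card S = ({0}ᶜ : Set V).ncard := rfl
    rw [this, Set.ncard_compl, Set.ncard_singleton]
  rw [← h2, Nat.card_congr (MulAction.selfEquivOrbitsQuotientProd h1), Nat.card_prod]
  exact Dvd.intro_left _ rfl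

theorem fixes_eq_zero_of_card {a : Equiv.Perm V} (ha : a ∈ additivePerm V) {q : ℕ} [Fact q.Prime]
    (haq : a ^ q = 1) (ha1 : a ≠ 1)
    (hc : ∀ d, d ∣ Nat.card V → Nat.card V ≡ d [MOD q] → d = 1 ∨ d = Nat.card V) {v : V}
    (hv : a v = v) : v = 0 := by
  have hA : Subgroup.zpowers a ≤ additivePerm V := by rwa [Subgroup.zpowers_le]
  rcases hc _ (AddSubgroup.card_addSubgroup_dvd_card _) (card_modEq_card_fixedAddSubgroup hA
    (q := q) (by
      rintro _ ⟨n, rfl⟩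
      change (a ^ n) ^ q = 1
      rw [← zpow_natCast, ← zpow_mul, mul_comm, zpow_mul, zpow_natCast, haq, one_zpow]))
    with h | h
  · have h' := AddSubgroup.card_eq_one.1 h
    have hv' := (mem_fixedAddSubgroup_zpowers hA).2 hv
    rwa [h'] at hv'
  · refine absurd (Equiv.ext fun x => ?_) ha1
    have h' := AddSubgroup.eq_top_of_card_eq _ h
    have hx : x ∈ fixedAddSubgroup _ hA := h' ▸ AddSubgroup.mem_top x
    exact (mem_fixedAddSubgroup_zpowers hA).1 hx

/-- A solvable irreducible linear group of characteristic two. -/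
structure IsSolvableLinear (H : Subgroup (Equiv.Perm V)) : Prop where
  isSolvable : Group.IsSolvable H
  le : H ≤ additivePerm V
  irreducible : ∀ W : AddSubgroup V, (∀ h ∈ H, ∀ w ∈ W, h w ∈ W) → W = ⊥ ∨ W = ⊤
  add_self : ∀ v : V, v + v = 0

theorem IsSolvableLinear.exists_normal {H : Subgroup (Equiv.Perm V)} (hH : IsSolvableLinear H)
    (hc : 2 < Nat.card V) : ∃ q : ℕ, q.Prime ∧ ∃ A ≤ H, A ≠ ⊥ ∧
      (∀ h ∈ H, ∀ m ∈ A, h * m * h⁻¹ ∈ A) ∧ (∀ x ∈ A, ∀ y ∈ A, x * y = y * x) ∧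
      (∀ x ∈ A, x ^ q = 1) ∧ (∀ v, (∀ a ∈ A, a v = v) → v = 0) ∧ Nat.card V ≡ 1 [MOD q] := by
  have hne : H ≠ ⊥ := by
    rintro rfl
    have : Nontrivial V := Finite.one_lt_card_iff_nontrivial.1 (by omega)
    obtain ⟨v, hv⟩ := exists_ne (0 : V)
    have hz : Nat.card (AddSubgroup.zmultiples v) ≤ 2 := by
      rw [Nat.card_zmultiples]
      exact Nat.le_of_dvd two_pos (addOrderOf_dvd_of_nsmul_eq_zero (by
        rw [two_nsmul, hH.add_self]))
    rcases hH.irreducible (AddSubgroup.zmultiples v) (fun h hh w hw => by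
      rw [Subgroup.mem_bot.1 hh]; exact hw) with h | h
    · rw [AddSubgroup.zmultiples_eq_bot] at h
      exact hv h
    · rw [h, AddSubgroup.card_top] at hz
      omega
  have := hH.isSolvable
  obtain ⟨q, hq, A, hAH, hA1, hA2, hA3, hA4⟩ := H.exists_normal_elementary_abelian hne
  have hA : A ≤ additivePerm V := hAH.trans hH.le
  have := Fact.mk hq
  have hF : fixedAddSubgroup A hA = ⊥ := by
    refine (hH.irreducible (fixedAddSubgroup A hA) fun h hh w hw a ha => ?_).resolve_right
      fun htop => hA1 ?_
    · have := hw _ (hA2 _ (H.inv_mem hh) a ha)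
      rw [inv_inv, Equiv.Perm.mul_apply, Equiv.Perm.mul_apply, Equiv.Perm.inv_eq_iff_eq] at this
      exact this
    · rw [eq_bot_iff]
      intro a ha
      ext v
      exact (htop ▸ AddSubgroup.mem_top v : v ∈ fixedAddSubgroup A hA) a ha
  refine ⟨q, hq, A, hAH, hA1, hA2, hA3, hA4, fun v hv => ?_, ?_⟩
  · have : v ∈ fixedAddSubgroup A hA := hv
    rwa [hF] at this
  · have := card_modEq_card_fixedAddSubgroup hA hA4
    rwa [hF, AddSubgroup.card_bot] at this

theorem exists_eq_zpowers_of_free {A : Subgroup (Equiv.Perm V)} (hA : A ≤ additivePerm V)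
    (hA1 : A ≠ ⊥) {q : ℕ} [hq : Fact q.Prime] (hAq : ∀ a ∈ A, a ^ q = 1)
    (hqc : ¬ q ^ 2 ∣ Nat.card V - 1) (hfree : ∀ a ∈ A, ∀ v, v ≠ 0 → a v = v → a = 1) :
    ∃ a ∈ A, a ≠ 1 ∧ A = Subgroup.zpowers a := by
  have hp : IsPGroup q A := fun a => ⟨1, by rw [pow_one]; exact Subtype.ext (hAq a a.2)⟩
  obtain ⟨n, hn⟩ := IsPGroup.iff_card.1 hp
  have hd := card_dvd_of_free hA hfree
  have hn2 : n ≤ 1 := by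
    by_contra! h
    exact hqc ((pow_dvd_pow q h).trans (hn ▸ hd))
  obtain ⟨a, ha, ha1⟩ := A.bot_or_exists_ne_one.resolve_left hA1
  refine ⟨a, ha, ha1, (Subgroup.eq_of_le_of_card_ge ?_ ?_).symm⟩
  · rwa [Subgroup.zpowers_le]
  · rw [Nat.card_zpowers, orderOf_eq_prime (hAq _ ha) ha1, hn]
    exact (Nat.pow_le_pow_right hq.out.pos hn2).trans_eq (pow_one q)

end AdditivePerm

theorem HasRigidSubset.succ {n p : ℕ} [Fact p.Prime] (h : HasRigidSubset (Fin n → ZMod p)) :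
    HasRigidSubset (Fin (n + 1) → ZMod p) := by
  obtain ⟨e⟩ := FiniteDimensional.nonempty_linearEquiv_of_finrank_eq (R := ZMod p)
    (M := (Fin n → ZMod p) × ZMod p) (M' := Fin (n + 1) → ZMod p) (by simp)
  exact (h.prod p).of_addEquiv e.toAddEquiv

theorem hasRigidSubset_pi {n p : ℕ} [hp : Fact p.Prime] (h9 : 9 < p ^ n) (h16 : p ^ n ≠ 16)
    (h32 : p ^ n ≠ 32) : HasRigidSubset (Fin n → ZMod p) := by
  have key : ∀ k, HasRigidSubset (Fin k → ZMod p) → k ≤ n → HasRigidSubset (Fin n → ZMod p) :=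
    fun k hk hkn => Nat.le_induction hk (fun _ _ ih => ih.succ) n hkn
  have hlt : ∀ k, p ^ k ≤ 9 → k < n := fun k hk => by
    by_contra! h
    exact absurd (Nat.pow_le_pow_right hp.out.pos h) (by omega)
  by_cases h11 : 11 ≤ p
  · refine key 1 ?_ (hlt 0 (by simp))
    obtain ⟨e⟩ := FiniteDimensional.nonempty_linearEquiv_of_finrank_eq (R := ZMod p)
      (M := ZMod p) (M' := Fin 1 → ZMod p) (by simp)
    exact (hasRigidSubset_of_eleven_le h11).of_addEquiv e.toAddEquiv
  · obtain rfl | rfl | rfl | rfl : p = 2 ∨ p = 3 ∨ p = 5 ∨ p = 7 := by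
      have hp' := hp.out
      clear * - hp' h11
      push Not at h11
      interval_cases p <;> revert hp' <;> norm_num
    · have h3 := hlt 3 (by norm_num)
      refine key 6 hasRigidSubset_two ?_
      have : n ≠ 4 := by rintro rfl; simp at h16
      have : n ≠ 5 := by rintro rfl; simp at h32
      omega
    · exact key 3 hasRigidSubset_three (hlt 2 (by norm_num))
    · exact key 2 hasRigidSubset_five (hlt 1 (by norm_num))
    · exact key 2 hasRigidSubset_seven (hlt 1 (by norm_num))

theorem natCard_eq_pow_finrank_zmod {V : Type*} [AddCommGroup V] [Finite V] (p : ℕ)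
    [Fact p.Prime] [Module (ZMod p) V] : Nat.card V = p ^ Module.finrank (ZMod p) V := by
  rw [Module.natCard_eq_pow_finrank (K := ZMod p), Nat.card_zmod]

theorem hasRigidSubset_of_module {V : Type*} [AddCommGroup V] [Finite V] (p : ℕ) [Fact p.Prime]
    [Module (ZMod p) V] (h9 : 9 < Nat.card V) (h16 : Nat.card V ≠ 16) (h32 : Nat.card V ≠ 32) :
    HasRigidSubset V := by
  have hc : Nat.card V = p ^ Module.finrank (ZMod p) V := by
    rw [Module.natCard_eq_pow_finrank (K := ZMod p), Nat.card_zmod]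
  obtain ⟨e⟩ := FiniteDimensional.nonempty_linearEquiv_of_finrank_eq (R := ZMod p)
    (M := Fin (Module.finrank (ZMod p) V) → ZMod p) (M' := V) (by simp)
  rw [hc] at h9 h16 h32
  exact (hasRigidSubset_pi h9 h16 h32).of_addEquiv e.toAddEquiv

section AffineGroup

variable {V : Type*} [AddCommGroup V] {G H : Subgroup (Equiv.Perm V)}

/-- The linear part of an affine group. -/
theorem IsSolvableAffine.isSolvableLinear [Finite V] (hG : IsSolvableAffine G)
    (h2 : ∀ v : V, v + v = 0) : IsSolvableLinear (G ⊓ additivePerm V) where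
  isSolvable :=
    have := hG.isSolvable
    Group.isSolvable_of_isSolvable_injective
      (Subgroup.inclusion_injective (inf_le_left : G ⊓ additivePerm V ≤ G))
  le := inf_le_right
  irreducible W hW := hG.irreducible W fun g hg h0 w hw =>
    hW g ⟨hg, (hG.isAffine g hg).map_add_of_map_zero h0⟩ w hw
  add_self := h2

theorem IsSolvableAffine.exists_linear (hG : IsSolvableAffine G) {g : Equiv.Perm V} (hg : g ∈ G) :
    ∃ h ∈ G ⊓ additivePerm V, ∀ x, g x = h x + g 0 := by
  have hG' : Equiv.addRight (-g 0) * g ∈ G := G.mul_mem (hG.addRight_mem _) hg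
  refine ⟨_, ⟨hG', (hG.isAffine _ hG').map_add_of_map_zero (by simp)⟩, fun x => by simp⟩

theorem affine_pow_apply {g h : Equiv.Perm V} (hh : h ∈ additivePerm V)
    (hgh : ∀ x, g x = h x + g 0) (n : ℕ) (x : V) : (g ^ n) x = (h ^ n) x + (g ^ n) 0 := by
  induction n generalizing x with
  | zero => simp
  | succ n ih =>
    rw [pow_succ', pow_succ', Equiv.Perm.mul_apply, Equiv.Perm.mul_apply, Equiv.Perm.mul_apply,
      ih, hgh, map_add_of_mem hh, add_assoc, ← hgh]

theorem mul_pow_of_mul_eq {P : Type*} [Group P] {a h : P} {k : ℕ} (hk : h * a = a ^ k * h) (n : ℕ) :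
    h * a ^ n = a ^ (k * n) * h := by
  rw [pow_mul]
  exact SemiconjBy.pow_right hk n

theorem pow_mul_of_mul_eq {P : Type*} [Group P] {a h : P} {k : ℕ} (hk : h * a = a ^ k * h) (n : ℕ) :
    h ^ n * a = a ^ (k ^ n) * h ^ n := by
  induction n with
  | zero => simp
  | succ n ih =>
    rw [pow_succ', mul_assoc, ih, ← mul_assoc, mul_pow_of_mul_eq hk, mul_assoc, pow_succ' k]

theorem exists_mul_eq_pow_mul {P : Type*} [Group P] [Finite P] {a h : P}
    (hn : h * a * h⁻¹ ∈ Subgroup.zpowers a) : ∃ k, h * a = a ^ k * h := by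
  obtain ⟨k, hk⟩ := mem_powers_iff_mem_zpowers.2 hn
  exact ⟨k, by rw [← mul_inv_eq_iff_eq_mul]; exact hk.symm⟩

theorem IsSolvableLinear.exists_singer_cycle [Finite V] (hH : IsSolvableLinear H)
    (hc : Nat.card V = 32) : ∃ a ∈ H, orderOf a = 31 ∧
      (∀ i : ℕ, ∀ v, v ≠ 0 → (a ^ i) v = v → 31 ∣ i) ∧
      (∀ v w, v ≠ 0 → w ≠ 0 → ∃ i, (a ^ i) v = w) ∧ ∀ h ∈ H, ∃ k, h * a = a ^ k * h := by
  obtain ⟨q, hq, A, hAH, hA1, hA2, hA3, hA4, hA5, hq1⟩ := hH.exists_normal (by omega)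
  obtain rfl : q = 31 := by
    rw [hc] at hq1
    have hd : q ∣ 31 := (Nat.modEq_iff_dvd' (by norm_num)).1 hq1.symm
    exact (Nat.prime_dvd_prime_iff_eq hq (by norm_num)).1 hd
  have := Fact.mk hq
  have hA := hAH.trans hH.le
  have hfix : ∀ a ∈ A, a ≠ 1 → ∀ v, a v = v → v = 0 := fun a ha ha1 v hv =>
    fixes_eq_zero_of_card (hA ha) (hA4 a ha) ha1 (fun d hd hm => by
      rw [hc] at hd hm ⊢
      have : d ∣ 2 ^ 5 := hd
      obtain ⟨k, hk, rfl⟩ := (Nat.dvd_prime_pow Nat.prime_two).1 this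
      interval_cases k <;> simp_all [Nat.ModEq]) hv
  obtain ⟨a, ha, ha1, rfl⟩ := exists_eq_zpowers_of_free hA hA1 hA4 (by rw [hc]; norm_num)
    fun a ha v hv0 hv => by_contra fun ha1 => hv0 (hfix a ha ha1 v hv)
  have ho : orderOf a = 31 := orderOf_eq_prime (hA4 a ha) ha1
  have hfree : ∀ i : ℕ, ∀ v, v ≠ 0 → (a ^ i) v = v → 31 ∣ i := fun i v hv0 hv => by
    rw [← ho, orderOf_dvd_iff_pow_eq_one]
    exact by_contra fun ha1 => hv0 (hfix _ (Subgroup.pow_mem _ ha i) ha1 v hv)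
  refine ⟨a, hAH ha, ho, hfree, fun v w hv hw => ?_, fun h hh =>
    exists_mul_eq_pow_mul (hA2 h hh a ha)⟩
  have hinj : Function.Injective fun i : Fin 31 => (a ^ (i : ℕ)) v := by
    have key : ∀ i j : ℕ, i ≤ j → j < 31 → (a ^ i) v = (a ^ j) v → i = j := by
      intro i j hij hj h
      obtain ⟨d, rfl⟩ := Nat.exists_eq_add_of_le hij
      rw [pow_add, Equiv.Perm.mul_apply] at h
      have := hfree d v hv ((a ^ i).injective h.symm)
      omega
    intro i j h
    rcases le_total i j with hij | hij
    · exact Fin.ext (key _ _ hij j.2 h)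
    · exact Fin.ext (key _ _ hij i.2 h.symm).symm
  have hr : (Set.range fun i : Fin 31 => (a ^ (i : ℕ)) v) = {0}ᶜ := by
    refine Set.eq_of_subset_of_ncard_le ?_ ?_ (Set.toFinite _)
    · rintro _ ⟨i, rfl⟩ h
      exact hv ((a ^ (i : ℕ)).injective
        (Eq.trans h (map_zero_of_mem (hA (Subgroup.pow_mem _ ha i))).symm))
    · rw [Set.ncard_compl, Set.ncard_singleton, hc, ← Set.image_univ,
        Set.ncard_image_of_injective _ hinj, Set.ncard_univ, Nat.card_fin]
  obtain ⟨i, hi⟩ := hr.symm ▸ (show w ∈ ({0}ᶜ : Set V) from hw)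
  exact ⟨i, hi⟩

theorem IsSolvableLinear.singer_exponent {a h : Equiv.Perm V} (h2 : ∀ v : V, v + v = 0)
    (ha : a ∈ additivePerm V) (ho : orderOf a = 31) {m : ℕ} (hm : ∀ y, y + a y = (a ^ m) y)
    (hh : h ∈ additivePerm V) {k : ℕ} (hk : h * a = a ^ k * h) (h6 : k ^ 6 ≡ 1 [MOD 31]) :
    k ≡ 1 [MOD 31] := by
  have hpow : ∀ {i j : ℕ}, a ^ i = a ^ j ↔ i % 31 = j % 31 := fun {i j} => by
    rw [pow_inj_mod, ho]
  have hap : ∀ i : ℕ, a ^ i ∈ additivePerm V := fun i => Subgroup.pow_mem _ ha i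
  set P : ℕ → Prop := fun i => ∀ y, y + (a ^ i) y = (a ^ (i * m)) y with hP
  have hP1 : P 1 := fun y => by simpa using hm y
  have hmod : ∀ i, P i → P (i % 31) := fun i hi y => by
    rw [hpow.2 (Nat.mod_mod i 31), hpow.2 (Nat.mod_mul_mod i m 31)]
    exact hi y
  have hdouble : ∀ i, P i → P (2 * i) := fun i hi y => by
    have h1 := hi (y + (a ^ i) y)
    rw [hi y, ← Equiv.Perm.mul_apply (a ^ (i * m)), ← pow_add, ← hi y, map_add_of_mem (hap i),
      ← Equiv.Perm.mul_apply (a ^ i), ← pow_add] at h1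
    rw [two_mul, add_mul, ← h1]
    calc y + (a ^ (i + i)) y = y + ((a ^ i) y + (a ^ i) y) + (a ^ (i + i)) y := by
          rw [h2, add_zero]
      _ = _ := by abel
  have hstep : ∀ i, P i → P (k % 31 * i % 31) := fun i hi => by
    have : P (k * i) := fun y => by
      have h1 := congrArg h (hi (h⁻¹ y))
      rw [map_add_of_mem hh, ← Equiv.Perm.mul_apply h (a ^ i),
        ← Equiv.Perm.mul_apply h (a ^ (i * m)),
        mul_pow_of_mul_eq hk, mul_pow_of_mul_eq hk] at h1
      simpa [mul_assoc] using h1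
    have h1 := hmod _ this
    rwa [← Nat.mod_mul_mod] at h1
  have hexcl : ∀ i j, P i → P j → P (i + j) → i % 31 = j % 31 := fun i j hi hj hij => by
    refine hpow.1 (Equiv.ext fun y => ?_)
    have h1 := hi (y + (a ^ j) y)
    rw [hj y, ← Equiv.Perm.mul_apply (a ^ (i * m)), ← pow_add, ← hj y, map_add_of_mem (hap i),
      ← Equiv.Perm.mul_apply (a ^ i), ← pow_add, ← add_mul, ← hij y] at h1
    have h3 : (a ^ i) y + (a ^ j) y = 0 := by
      have : (a ^ i) y + (a ^ j) y + (y + (a ^ (i + j)) y) = 0 + (y + (a ^ (i + j)) y) := by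
        rw [zero_add]
        nth_rewrite 2 [← h1]
        abel
      exact add_right_cancel this
    exact add_right_cancel (h3.trans (h2 _).symm)
  have hP2 := hdouble 1 hP1
  have hP4 := hdouble 2 hP2
  have hr : k % 31 < 31 := Nat.mod_lt _ (by norm_num)
  have hr6 : (k % 31) ^ 6 % 31 = 1 := by rw [← Nat.pow_mod]; exact h6
  change k % 31 = 1
  generalize k % 31 = r at *
  have hcases : r = 1 ∨ r = 5 ∨ r = 6 ∨ r = 25 ∨ r = 26 ∨ r = 30 := by
    clear * - hr hr6
    interval_cases r <;> simp_all
  rcases hcases with rfl | rfl | rfl | rfl | rfl | rfl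
  · rfl
  · exact absurd (hexcl 1 4 hP1 hP4 (hstep 1 hP1)) (by norm_num)
  · exact absurd (hexcl 2 4 hP2 hP4 (hstep 1 hP1)) (by norm_num)
  · exact absurd (hexcl 1 4 hP1 hP4 (hstep _ (hstep 1 hP1))) (by norm_num)
  · exact absurd (hexcl 1 4 hP1 hP4 (hstep _ (hstep _ (hstep _ (hstep 1 hP1))))) (by norm_num)
  · have hP30 : P 30 := hstep 1 hP1
    have h16 : m % 31 = 16 := by
      have : (30 * m + 1) % 31 = m % 31 := hpow.1 <| Equiv.ext fun y => by
        rw [pow_succ', Equiv.Perm.mul_apply, ← hP30 y, map_add_of_mem ha, ← hm y,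
          ← Equiv.Perm.mul_apply a, ← pow_succ', hpow.2 (show (30 + 1) % 31 = 0 % 31 by norm_num)]
        simp [add_comm]
      omega
    have h3 : a ^ 2 = a ^ m := Equiv.ext fun y => by
      have h4 := hP2 y
      rw [hpow.2 (show 2 * 1 * m % 31 = 1 % 31 by omega), pow_one] at h4
      rw [← hm y, ← h4, ← add_assoc, h2, zero_add]
    have := hpow.1 h3
    omega

theorem IsSolvableAffine.exists_rigid_of_card_eq_thirtyTwo [Finite V] (hG : IsSolvableAffine G)
    (h2 : ∀ v : V, v + v = 0) (hc : Nat.card V = 32) : ∃ Δ : Set V, 2 * Δ.ncard ≠ Nat.card V ∧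
      ∀ g ∈ G, (∀ x, g x ∈ Δ ↔ x ∈ Δ) → g = 1 := by
  obtain ⟨a, ha, ho, hfree, htrans, hnorm⟩ :=
    (hG.isSolvableLinear h2).exists_singer_cycle hc
  have : Nontrivial V := Finite.one_lt_card_iff_nontrivial.1 (by omega)
  obtain ⟨v, hv⟩ := exists_ne (0 : V)
  have ha' := ha.2
  have ha0 : ∀ w, a w = 0 → w = 0 := fun w hw => a.injective (hw.trans (map_zero_of_mem ha').symm)
  have hav0 : a v ≠ 0 := fun h => hv (ha0 v h)
  have hav : a v ≠ v := fun h => absurd (hfree 1 v hv (by simpa using h)) (by norm_num)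
  have hgen : ∀ h ∈ additivePerm V, ∀ i : ℕ, h * a = a * h → h v = (a ^ i) v → h = a ^ i := by
    refine fun h hh i hha hhv => Equiv.ext fun w => ?_
    by_cases hw : w = 0
    · rw [hw, map_zero_of_mem hh, map_zero_of_mem (Subgroup.pow_mem _ ha' i)]
    · obtain ⟨j, rfl⟩ := htrans v w hv hw
      have hc : Commute h (a ^ j) := (show Commute h a from hha).pow_right j
      rw [← Equiv.Perm.mul_apply, hc.eq, Equiv.Perm.mul_apply, hhv, ← Equiv.Perm.mul_apply,
        ← Equiv.Perm.mul_apply, (Commute.pow_pow_self a j i).eq]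
  obtain ⟨m, hm⟩ : ∃ m : ℕ, ∀ y, y + a y = (a ^ m) y := by
    obtain ⟨m, hm⟩ := htrans v (v + a v) hv fun h => hav (add_left_cancel (h.trans (h2 v).symm))
    refine ⟨m, fun y => ?_⟩
    by_cases hy : y = 0
    · rw [hy, map_zero_of_mem ha', map_zero_of_mem (Subgroup.pow_mem _ ha' m), add_zero]
    · obtain ⟨j, rfl⟩ := htrans v y hv hy
      rw [← Equiv.Perm.mul_apply (a ^ m), (Commute.pow_pow_self a m j).eq, Equiv.Perm.mul_apply,
        hm, map_add_of_mem (Subgroup.pow_mem _ ha' j), ← Equiv.Perm.mul_apply a,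
        ← Equiv.Perm.mul_apply (a ^ j), (Commute.self_pow a j).eq]
  have hpt : ∀ h ∈ G ⊓ additivePerm V, h v = v → h (a v) = a v → h = 1 := by
    intro h hh hhv hhav
    obtain ⟨k, hk⟩ := hnorm h hh
    have h1 : (a ^ k) v = a v := by
      rw [← hhav, ← Equiv.Perm.mul_apply h, hk, Equiv.Perm.mul_apply, hhv]
    have h3 : a ^ k = a ^ 1 := hgen _ (Subgroup.pow_mem _ ha' k) 1
      (Commute.pow_self a k) (by rw [h1, pow_one])
    rw [h3, pow_one] at hk
    simpa using hgen h hh.2 0 hk (by simpa using hhv)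
  have hcard : ({0, v, a v} : Set V).ncard = 3 :=
    Set.ncard_eq_three.2 ⟨0, v, a v, hv.symm, hav0.symm, hav.symm, rfl⟩
  refine ⟨{0, v, a v}, by rw [hcard]; omega, fun g hg hΔ => ?_⟩
  have hg6 : ∀ x ∈ ({0, v, a v} : Set V), (g ^ 6) x = x := by
    intro x hx
    have h1 := pow_card_eq_one' (x := g.subtypePerm hΔ)
    rw [Nat.card_perm, show Nat.card {x // x ∈ ({0, v, a v} : Set V)} = 3 from hcard,
      Equiv.Perm.subtypePerm_pow] at h1
    exact congrArg Subtype.val (Equiv.congr_fun h1 ⟨x, hx⟩)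
  obtain ⟨h, hh, hgh⟩ := hG.exists_linear hg
  have hg6' : g ^ 6 = 1 := by
    have h0 := hg6 0 (by simp)
    refine hpt _ ⟨G.pow_mem hg 6, ?_⟩ (hg6 v (by simp)) (hg6 _ (by simp))
    exact (hG.isAffine _ (G.pow_mem hg 6)).map_add_of_map_zero h0
  have hh6 : h ^ 6 = 1 := by
    ext x
    have := affine_pow_apply hh.2 hgh 6 x
    rw [hg6', Equiv.Perm.one_apply, Equiv.Perm.one_apply, add_zero] at this
    exact this.symm
  obtain ⟨k, hk⟩ := hnorm h hh
  have hk6 : k ^ 6 ≡ 1 [MOD 31] := by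
    have := pow_mul_of_mul_eq hk 6
    rw [hh6, one_mul, mul_one] at this
    rw [← ho, ← pow_eq_pow_iff_modEq, ← this, pow_one]
  have hk1 := IsSolvableLinear.singer_exponent h2 ha' ho hm hh.2 hk hk6
  rw [← ho, ← pow_eq_pow_iff_modEq, pow_one] at hk1
  rw [hk1] at hk
  obtain ⟨i, hi⟩ := htrans v (h v) hv fun h0 =>
    hv (h.injective (h0.trans (map_zero_of_mem hh.2).symm))
  have hhi := hgen h hh.2 i hk hi.symm
  have hh1 : h = 1 := by
    rw [hhi, ← pow_mul, ← orderOf_dvd_iff_pow_eq_one, ho] at hh6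
    rw [hhi, ← orderOf_dvd_iff_pow_eq_one, ho]
    omega
  subst hh1
  have hsum : v + a v ∉ ({0, v, a v} : Set V) := by
    rintro (h | h | h)
    · exact hav (add_left_cancel (h.trans (h2 v).symm))
    · exact hav0 (by simpa using h)
    · exact hv (by simpa using h)
  have h0 : g 0 = 0 := by
    rcases (hΔ 0).2 (by simp) with h | h | h
    · exact h
    · refine absurd ((hΔ (a v)).2 (by simp)) ?_
      rwa [hgh, h, Equiv.Perm.one_apply, add_comm]
    · refine absurd ((hΔ v).2 (by simp)) ?_
      rwa [hgh, h, Equiv.Perm.one_apply]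
  ext x
  rw [hgh, h0, add_zero]

end AffineGroup

/-- Multiplication by `x` on `𝔽₂[x] / (x⁴ + x³ + x² + x + 1)`, on the
binary codes of polynomials. -/
def quinticShift (m : ℕ) : ℕ := if m < 8 then 2 * m else (2 * m) ^^^ 31

/-- The vector of the cyclic subspace spanned by `v`, `x v`, `x² v`, `x³ v` with binary code `m`. -/
def quinticVector {V : Type*} [AddCommGroup V] (x : Equiv.Perm V) (v : V) (m : ℕ) : V :=
  (if m.testBit 0 then v else 0) + (if m.testBit 1 then x v else 0) +
    (if m.testBit 2 then x (x v) else 0) + if m.testBit 3 then x (x (x v)) else 0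

theorem quinticShift_lt : ∀ m < 16, quinticShift m < 16 := by decide

theorem quinticShift_rigid : ∀ (w : Fin 16) (k : Fin 5) (c : Fin 16), w ≠ 0 → k ≠ 0 →
    (∀ m ∈ [c.1, w ^^^ c, quinticShift^[k] w ^^^ c, w ^^^ quinticShift^[2 * k.1] w ^^^ c],
      m ∈ [0, 1, 2, 5]) → w = 1 ∧ k = 1 ∧ c = 0 := by
  decide +kernel

section Quintic

variable {V : Type*} [AddCommGroup V] {x : Equiv.Perm V} {v : V}

theorem quinticVector_xor (h2 : ∀ v : V, v + v = 0) (m n : ℕ) :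
    quinticVector x v (m ^^^ n) = quinticVector x v m + quinticVector x v n := by
  have key : ∀ (a b : Bool) (u : V), (if (a ^^ b) = true then u else 0) =
      (if a = true then u else 0) + if b = true then u else 0 := by
    rintro (_ | _) (_ | _) u <;> simp [h2]
  simp only [quinticVector, Nat.testBit_xor, key]
  abel

theorem apply_quinticVector (h2 : ∀ v : V, v + v = 0) (hx : x ∈ additivePerm V)
    (hv : x (x (x (x v))) = v + x v + x (x v) + x (x (x v))) {m : ℕ} (hm : m < 16) :
    x (quinticVector x v m) = quinticVector x v (quinticShift m) := by
  have h0 := map_zero_of_mem hx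
  have h2' : ∀ a b : V, a + (a + b) = b := fun a b => by rw [← add_assoc, h2, zero_add]
  have hc : ∀ (p : Prop) [Decidable p] (u : V), x (if p then u else 0) = if p then x u else 0 :=
    fun p _ u => by split_ifs <;> simp [h0]
  simp only [quinticVector, map_add_of_mem hx, hc, hv]
  interval_cases m <;> simp [quinticShift, Nat.testBit_succ] <;>
    simp [add_comm, add_left_comm, h2, h2']

theorem quinticVector_bijective [Finite V] (h2 : ∀ v : V, v + v = 0) (hc : Nat.card V = 16)
    (hx : x ∈ additivePerm V) (hx5 : x ^ 5 = 1) (hfix : ∀ u, x u = u → u = 0)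
    (hx4 : x (x (x (x v))) = v + x v + x (x v) + x (x (x v))) (hv : v ≠ 0) :
    Function.Bijective fun m : Fin 16 => quinticVector x v m := by
  have := Fact.mk Nat.prime_five
  let W : AddSubgroup V :=
    { carrier := {u | ∃ m < 16, quinticVector x v m = u}
      zero_mem' := ⟨0, by norm_num, by simp [quinticVector]⟩
      add_mem' := by
        rintro _ _ ⟨m, hm, rfl⟩ ⟨n, hn, rfl⟩
        exact ⟨m ^^^ n, Nat.xor_lt_two_pow (n := 4) hm hn, quinticVector_xor h2 m n⟩
      neg_mem' := fun {u} hu => by rwa [neg_eq_of_add_eq_zero_left (h2 u)] }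
  have hxW : ∀ u ∈ W, x u ∈ W := by
    rintro _ ⟨m, hm, rfl⟩
    exact ⟨_, quinticShift_lt m hm, (apply_quinticVector h2 hx hx4 hm).symm⟩
  have hA : Subgroup.zpowers x ≤ additivePerm V := by rwa [Subgroup.zpowers_le]
  have hpow : ∀ a ∈ Subgroup.zpowers x, ∃ n : ℕ, x ^ n = a := fun a ha =>
    mem_powers_iff_mem_zpowers.2 ha
  have hcard := card_modEq_card_inf_fixedAddSubgroup hA (q := 5) (fun a ha => by
    obtain ⟨n, rfl⟩ := hpow a ha
    rw [← pow_mul, mul_comm, pow_mul, hx5, one_pow]) W (fun a ha w hw => by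
    obtain ⟨n, rfl⟩ := hpow a ha
    induction n with
    | zero => exact hw
    | succ n ih =>
      rw [pow_succ']
      exact hxW _ (ih (Subgroup.pow_mem _ (Subgroup.mem_zpowers x) n)))
  have hF : W ⊓ fixedAddSubgroup _ hA = ⊥ := by
    rw [eq_bot_iff]
    rintro u ⟨-, hu⟩
    exact hfix u ((mem_fixedAddSubgroup_zpowers hA).1 hu)
  rw [hF, AddSubgroup.card_bot] at hcard
  have hdvd : Nat.card W ∣ 2 ^ 4 := by
    have := AddSubgroup.card_addSubgroup_dvd_card W
    rwa [hc] at this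
  have hW : W = ⊤ := by
    have hne : Nat.card W ≠ 1 := fun h => hv <| by
      have hvW : v ∈ W := ⟨1, by norm_num, by simp [quinticVector, Nat.testBit_succ]⟩
      rwa [AddSubgroup.card_eq_one.1 h] at hvW
    obtain ⟨k, hk, hWk⟩ := (Nat.dvd_prime_pow Nat.prime_two).1 hdvd
    rw [hWk] at hcard hne
    refine AddSubgroup.eq_top_of_card_eq _ ?_
    rw [hWk, hc]
    interval_cases k <;> simp_all [Nat.ModEq]
  refine Function.Surjective.bijective_of_nat_card_le (fun u => ?_) (by simp [hc])
  obtain ⟨m, hm, rfl⟩ := (hW ▸ AddSubgroup.mem_top u : u ∈ W)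
  exact ⟨⟨m, hm⟩, rfl⟩

theorem IsSolvableAffine.exists_rigid_of_quintic [Finite V] {G : Subgroup (Equiv.Perm V)}
    (hG : IsSolvableAffine G) (h2 : ∀ v : V, v + v = 0) (hc : Nat.card V = 16)
    (hx : x ∈ additivePerm V) (hx5 : x ^ 5 = 1) (hx1 : x ≠ 1)
    (hnorm : ∀ h ∈ G ⊓ additivePerm V, ∃ k, h * x = x ^ k * h) :
    ∃ Δ : Set V, 2 * Δ.ncard ≠ Nat.card V ∧ ∀ g ∈ G, (∀ y, g y ∈ Δ ↔ y ∈ Δ) → g = 1 := by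
  have := Fact.mk Nat.prime_five
  have : Nontrivial V := Finite.one_lt_card_iff_nontrivial.1 (by omega)
  obtain ⟨v, hv⟩ := exists_ne (0 : V)
  have hfix : ∀ u, x u = u → u = 0 := fun u => fixes_eq_zero_of_card hx hx5 hx1 fun d hd hm => by
    rw [hc] at hd hm ⊢
    obtain ⟨k, hk, rfl⟩ := (Nat.dvd_prime_pow (m := 4) Nat.prime_two).1 hd
    interval_cases k <;> simp_all [Nat.ModEq]
  have hx4 : x (x (x (x v))) = v + x v + x (x v) + x (x (x v)) := by
    have h5 : x (x (x (x (x v)))) = v := Equiv.congr_fun hx5 v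
    have := hfix (v + x v + x (x v) + x (x (x v)) + x (x (x (x v)))) (by
      simp only [map_add_of_mem hx, h5]
      abel)
    exact (add_right_cancel (this.trans (h2 _).symm)).symm
  have hbij := quinticVector_bijective h2 hc hx hx5 hfix hx4 hv
  set E : ℕ → V := quinticVector x v with hE
  have hEinj : ∀ m < 16, ∀ n < 16, E m = E n → m = n := fun m hm n hn h =>
    congrArg Fin.val (@hbij.1 ⟨m, hm⟩ ⟨n, hn⟩ h)
  have hEsurj : ∀ u, ∃ m < 16, E m = u := fun u => by
    obtain ⟨m, rfl⟩ := hbij.2 u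
    exact ⟨m, m.2, rfl⟩
  have hshift : ∀ n m, m < 16 →
      quinticShift^[n] m < 16 ∧ (x ^ n) (E m) = E (quinticShift^[n] m) := by
    intro n
    induction n with
    | zero => exact fun m hm => ⟨hm, rfl⟩
    | succ n ih =>
      intro m hm
      obtain ⟨h1, h3⟩ := ih _ (quinticShift_lt m hm)
      refine ⟨h1, ?_⟩
      rw [pow_succ, Equiv.Perm.mul_apply, hE, apply_quinticVector h2 hx hx4 hm]
      exact h3
  have hlt : ∀ {m n}, m < 16 → n < 16 → m ^^^ n < 16 := fun hm hn =>
    Nat.xor_lt_two_pow (n := 4) hm hn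
  have hE0 : E 0 = 0 := by simp [hE, quinticVector]
  have hE1 : E 1 = v := by simp [hE, quinticVector, Nat.testBit_succ]
  have hE2 : E 2 = x v := by simp [hE, quinticVector, Nat.testBit_succ]
  have hE5 : E 5 = v + x (x v) := by simp [hE, quinticVector, Nat.testBit_succ]
  set L : List ℕ := [0, 1, 2, 5] with hL
  have hL16 : ∀ m ∈ L, m < 16 := by decide
  refine ⟨E '' {m | m ∈ L}, ?_, fun g hg hΔ => ?_⟩
  · have hinj : Set.InjOn E {m | m ∈ L} := fun m hm n hn => hEinj m (hL16 m hm) n (hL16 n hn)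
    rw [hinj.ncard_image, hc,
      show {m | m ∈ L} = (({0, 1, 2, 5} : Finset ℕ) : Set ℕ) by ext; simp [hL],
      Set.ncard_coe_finset]
    decide
  have hmem : ∀ m < 16, E m ∈ E '' {m | m ∈ L} → m ∈ L := by
    rintro m hm ⟨n, hn, h⟩
    rwa [← hEinj n (hL16 n hn) m hm h]
  obtain ⟨h, hh, hgh⟩ := hG.exists_linear hg
  obtain ⟨k, hk⟩ := hnorm h hh
  replace hk : h * x = x ^ (k % 5) * h := by rwa [← pow_eq_pow_mod k hx5]
  have hk5 : k % 5 < 5 := Nat.mod_lt _ (by norm_num)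
  generalize k % 5 = k at hk hk5
  obtain ⟨c, hc16, hgc⟩ := hEsurj (g 0)
  obtain ⟨w, hw16, hw⟩ := hEsurj (h v)
  obtain ⟨hs1, hs1'⟩ := hshift k w hw16
  obtain ⟨hs2, hs2'⟩ := hshift (2 * k) w hw16
  have hhx : ∀ u, h (x u) = (x ^ k) (h u) := fun u => Equiv.congr_fun hk u
  have hrigid := quinticShift_rigid ⟨w, hw16⟩ ⟨k, hk5⟩ ⟨c, hc16⟩ ?_ ?_ ?_
  · obtain ⟨hw1, hk1, hc0⟩ := hrigid
    obtain rfl : w = 1 := congrArg Fin.val hw1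
    obtain rfl : k = 1 := congrArg Fin.val hk1
    obtain rfl : c = 0 := congrArg Fin.val hc0
    rw [hE1] at hw
    simp only [pow_one] at hhx
    ext u
    rw [hgh, ← hgc, hE0, add_zero]
    obtain ⟨m, -, rfl⟩ := hEsurj u
    have hif : ∀ (p : Prop) [Decidable p] (u : V), h (if p then u else 0) = if p then h u else 0 :=
      fun p _ u => by split_ifs <;> simp [map_zero_of_mem hh.2]
    simp only [hE, quinticVector, map_add_of_mem hh.2, hif, hhx, ← hw, Equiv.Perm.one_apply]
  · rintro h0
    obtain rfl : w = 0 := congrArg Fin.val h0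
    rw [hE0] at hw
    exact hv (h.injective (hw.symm.trans (map_zero_of_mem hh.2).symm))
  · rintro h0
    obtain rfl : k = 0 := congrArg Fin.val h0
    refine hv (hfix v (h.injective ?_))
    rw [hhx, pow_zero, Equiv.Perm.one_apply]
  · have h0 := (hΔ (E 0)).2 ⟨0, by decide, rfl⟩
    have h1 := (hΔ (E 1)).2 ⟨1, by decide, rfl⟩
    have h3 := (hΔ (E 2)).2 ⟨2, by decide, rfl⟩
    have h5 := (hΔ (E 5)).2 ⟨5, by decide, rfl⟩
    rw [hE0, ← hgc] at h0
    rw [hE1, hgh, ← hw, ← hgc, hE, ← quinticVector_xor h2] at h1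
    rw [hE2, hgh, hhx, ← hw, hs1', ← hgc, hE, ← quinticVector_xor h2] at h3
    rw [hE5, hgh, map_add_of_mem hh.2, hhx, hhx, ← Equiv.Perm.mul_apply, ← pow_add, ← two_mul,
      ← hw, hs2', ← hgc, hE, ← quinticVector_xor h2, ← quinticVector_xor h2] at h5
    simp only [List.forall_mem_cons, List.not_mem_nil, false_imp_iff, implies_true, and_true]
    exact ⟨hmem _ hc16 h0, hmem _ (hlt hw16 hc16) h1, hmem _ (hlt hs1 hc16) h3,
      hmem _ (hlt (hlt hw16 hs2) hc16) h5⟩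

end Quintic

/-- A `4 × 4` pattern with no nontrivial row, column and transposition symmetries. -/
def gridPattern : Fin 4 → Fin 4 → Bool :=
  ![![true, true, false, true], ![false, true, true, false], ![true, false, false, false],
    ![false, false, false, false]]

theorem gridPattern_row : ∀ i i' : Fin 4, ∀ τ : Fin 4 → Fin 4, Function.Injective τ →
    (∀ j, gridPattern i' (τ j) = gridPattern i j) → i' = i := by
  decide +kernel

theorem gridPattern_column : ∀ j j' : Fin 4,
    (∀ i, gridPattern i j' = gridPattern i j) → j' = j := by
  decide

theorem gridPattern_transpose : ∀ j' : Fin 4, ∀ τ : Fin 4 → Fin 4, Function.Injective τ →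
    ¬ ∀ j, gridPattern (τ j) j' = gridPattern 0 j := by
  decide +kernel

theorem exists_rigid_of_grid {V : Type*} {G : Subgroup (Equiv.Perm V)}
    (F : Fin 4 × Fin 4 ≃ V) (hF : ∀ g ∈ G, ∃ σ τ : Fin 4 → Fin 4,
      (∀ i j, g (F (i, j)) = F (σ i, τ j)) ∨ ∀ i j, g (F (i, j)) = F (τ j, σ i)) :
    ∃ Δ : Set V, 2 * Δ.ncard ≠ Nat.card V ∧ ∀ g ∈ G, (∀ y, g y ∈ Δ ↔ y ∈ Δ) → g = 1 := by
  refine ⟨F '' {p | gridPattern p.1 p.2 = true}, ?_, fun g hg hΔ => ?_⟩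
  · rw [Set.ncard_image_of_injective _ F.injective, ← Nat.card_congr F,
      show {p : Fin 4 × Fin 4 | gridPattern p.1 p.2 = true} =
        ((Finset.univ.filter fun p : Fin 4 × Fin 4 => gridPattern p.1 p.2 = true :
          Finset (Fin 4 × Fin 4)) : Set (Fin 4 × Fin 4)) by ext; simp,
      Set.ncard_coe_finset, Nat.card_eq_fintype_card]
    decide
  have hmem : ∀ i j, F (i, j) ∈ F '' {p | gridPattern p.1 p.2 = true} ↔ gridPattern i j = true :=
    fun i j => by rw [F.injective.mem_set_image]; rfl
  obtain ⟨σ, τ, h | h⟩ := hF g hg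
  · have hinj : Function.Injective τ := fun j j' hj => by
      have h1 : g (F (0, j)) = g (F (0, j')) := by rw [h, h, hj]
      exact congrArg Prod.snd (F.injective (g.injective h1))
    have hp : ∀ i j, gridPattern (σ i) (τ j) = gridPattern i j := fun i j => by
      rw [Bool.eq_iff_iff, ← hmem, ← hmem, ← h, hΔ]
    have hσ : ∀ i, σ i = i := fun i => gridPattern_row i (σ i) τ hinj (hp i)
    have hτ : ∀ j, τ j = j := fun j => gridPattern_column j (τ j) fun i => by
      rw [← hp i j, hσ]
    ext u
    obtain ⟨⟨i, j⟩, rfl⟩ := F.surjective u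
    rw [h, hσ, hτ, Equiv.Perm.one_apply]
  · have hinj : Function.Injective τ := fun j j' hj => by
      have h1 : g (F (0, j)) = g (F (0, j')) := by rw [h, h, hj]
      exact congrArg Prod.snd (F.injective (g.injective h1))
    refine absurd (fun j => ?_) (gridPattern_transpose (σ 0) τ hinj)
    rw [Bool.eq_iff_iff, ← hmem, ← hmem, ← h, hΔ]

theorem IsSolvableAffine.exists_rigid_of_decomposition {V : Type*} [AddCommGroup V] [Finite V]
    {G : Subgroup (Equiv.Perm V)} (hG : IsSolvableAffine G) (hc : Nat.card V = 16)
    {U U' : AddSubgroup V} (hU : Nat.card U = 4) (hU' : Nat.card U' = 4)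
    (hUU' : U ⊓ U' = ⊥) (hH : ∀ h ∈ G ⊓ additivePerm V,
      ((∀ u ∈ U, h u ∈ U) ∧ ∀ u ∈ U', h u ∈ U') ∨ (∀ u ∈ U, h u ∈ U') ∧ ∀ u ∈ U', h u ∈ U) :
    ∃ Δ : Set V, 2 * Δ.ncard ≠ Nat.card V ∧ ∀ g ∈ G, (∀ y, g y ∈ Δ ↔ y ∈ Δ) → g = 1 := by
  let e : Fin 4 ≃ U := (Finite.equivFinOfCardEq hU).symm
  let e' : Fin 4 ≃ U' := (Finite.equivFinOfCardEq hU').symm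
  have hinj : Function.Injective fun p : Fin 4 × Fin 4 => (e p.1 + e' p.2 : V) := by
    rintro ⟨i, j⟩ ⟨i', j'⟩ h
    have h1 : (e i - e i' : V) = e' j' - e' j := by
      rw [sub_eq_sub_iff_add_eq_add, add_comm (e' j' : V)]; exact h
    have h2 : (e i - e i' : V) ∈ U ⊓ U' :=
      ⟨U.sub_mem (e i).2 (e i').2, h1 ▸ U'.sub_mem (e' j').2 (e' j).2⟩
    rw [hUU', AddSubgroup.mem_bot] at h2
    rw [h2] at h1
    rw [e.injective (Subtype.ext (sub_eq_zero.1 h2)),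
      e'.injective (Subtype.ext (sub_eq_zero.1 h1.symm))]
  let F : Fin 4 × Fin 4 ≃ V := Equiv.ofBijective _
    (hinj.bijective_of_nat_card_le (by rw [hc]; simp))
  have hF : ∀ i j, F (i, j) = e i + e' j := fun i j => rfl
  refine exists_rigid_of_grid F fun g hg => ?_
  obtain ⟨h, hh, hgh⟩ := hG.exists_linear hg
  obtain ⟨⟨a, b⟩, hab⟩ := F.surjective (g 0)
  rw [hF] at hab
  have he : ∀ u (hu : u ∈ U), (e (e.symm ⟨u, hu⟩) : V) = u := fun u hu => by simp
  have he' : ∀ u (hu : u ∈ U'), (e' (e'.symm ⟨u, hu⟩) : V) = u := fun u hu => by simp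
  rcases hH h hh with ⟨h1, h2⟩ | ⟨h1, h2⟩
  · refine ⟨fun i => e.symm ⟨_, U.add_mem (h1 _ (e i).2) (e a).2⟩,
      fun j => e'.symm ⟨_, U'.add_mem (h2 _ (e' j).2) (e' b).2⟩, .inl fun i j => ?_⟩
    rw [hF, hF, he, he', hgh, map_add_of_mem hh.2, ← hab]
    abel
  · refine ⟨fun i => e'.symm ⟨_, U'.add_mem (h1 _ (e i).2) (e' b).2⟩,
      fun j => e.symm ⟨_, U.add_mem (h2 _ (e' j).2) (e a).2⟩, .inr fun i j => ?_⟩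
    rw [hF, hF, he, he', hgh, map_add_of_mem hh.2, ← hab]
    abel

/-- The linear action of a group of additive permutations. -/
abbrev distribMulActionOfLe {V : Type*} [AddCommGroup V] {H : Subgroup (Equiv.Perm V)}
    (hH : H ≤ additivePerm V) : DistribMulAction H V :=
  { (inferInstance : MulAction H V) with
    smul_zero := fun h => map_zero_of_mem (hH h.2)
    smul_add := fun h => map_add_of_mem (hH h.2) }

theorem AddSubgroup.natCard_smul {α V : Type*} [Group α] [AddCommGroup V] [DistribMulAction α V]
    (h : α) (U : AddSubgroup V) : Nat.card (h • U : AddSubgroup V) = Nat.card U :=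
  Set.natCard_smul_set h (U : Set V)

theorem Nat.eq_one_or_four_or_sixteen {n : ℕ} (h : n ∣ 16) (h3 : 16 ≡ n [MOD 3]) :
    n = 1 ∨ n = 4 ∨ n = 16 := by
  have : ∀ n ≤ 16, n ∣ 16 → 16 % 3 = n % 3 → n = 1 ∨ n = 4 ∨ n = 16 := by decide
  exact this n (Nat.le_of_dvd (by norm_num) h) h h3

section Decomposition

variable {V : Type*} [AddCommGroup V] {H : Subgroup (Equiv.Perm V)}

/-- The group `H` preserves a decomposition of `V` into two summands of order four. -/
def PreservesDecomposition (H : Subgroup (Equiv.Perm V)) : Prop :=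
  ∃ U U' : AddSubgroup V, Nat.card U = 4 ∧ Nat.card U' = 4 ∧ U ⊓ U' = ⊥ ∧ ∀ h ∈ H,
    ((∀ u ∈ U, h u ∈ U) ∧ ∀ u ∈ U', h u ∈ U') ∨ (∀ u ∈ U, h u ∈ U') ∧ ∀ u ∈ U', h u ∈ U

theorem IsSolvableLinear.exists_smul_ne (hH : IsSolvableLinear H) (hc : Nat.card V = 16)
    {U : AddSubgroup V} (hU : Nat.card U = 4) :
    letI := distribMulActionOfLe hH.le
    ∃ h : H, h • U ≠ U := by
  let _ := distribMulActionOfLe hH.le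
  change ∃ h : H, h • U ≠ U
  by_contra! hall
  rcases hH.irreducible U (fun h hh w hw => by
    rw [← hall ⟨h, hh⟩]
    exact AddSubgroup.smul_mem_pointwise_smul w (⟨h, hh⟩ : H) U hw) with h | h
  · rw [h, AddSubgroup.card_bot] at hU
    omega
  · rw [h, AddSubgroup.card_top] at hU
    omega

variable [Finite V]

theorem IsSolvableLinear.preservesDecomposition_of_orbit (hH : IsSolvableLinear H)
    (hc : Nat.card V = 16) {U : AddSubgroup V} (hU : Nat.card U = 4) :
    letI := distribMulActionOfLe hH.le
    (∀ h : H, h • U ≠ U → U ⊓ h • U = ⊥) → (MulAction.orbit H U).ncard ≤ 2 →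
      PreservesDecomposition H := by
  let _ := distribMulActionOfLe hH.le
  change (∀ h : H, h • U ≠ U → U ⊓ h • U = ⊥) → (MulAction.orbit H U).ncard ≤ 2 → _
  intro hdisj horb
  obtain ⟨h, hh⟩ : ∃ h : H, h • U ≠ U := hH.exists_smul_ne hc hU
  have horb' : {U, h • U} = MulAction.orbit H U := by
    refine Set.eq_of_subset_of_ncard_le ?_ (by rwa [Set.ncard_pair hh.symm]) (Set.toFinite _)
    rintro W (rfl | rfl)
    · exact MulAction.mem_orbit_self _
    · exact MulAction.mem_orbit _ _
  refine ⟨U, h • U, hU, ?_, hdisj h hh, fun k hk => ?_⟩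
  · rw [AddSubgroup.natCard_smul, hU]
  · have hmem : ∀ W W' : AddSubgroup V, (⟨k, hk⟩ : H) • W = W' → ∀ u ∈ W, k u ∈ W' := by
      rintro W _ rfl u hu
      exact AddSubgroup.smul_mem_pointwise_smul u (⟨k, hk⟩ : H) W hu
    have h1 : (⟨k, hk⟩ : H) • U ∈ ({U, h • U} : Set (AddSubgroup V)) := by
      rw [horb']
      exact MulAction.mem_orbit _ _
    have h2 : (⟨k, hk⟩ : H) • h • U ∈ ({U, h • U} : Set (AddSubgroup V)) := by
      rw [horb', ← mul_smul]
      exact MulAction.mem_orbit _ _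
    rcases h1 with h1 | h1 <;> rcases h2 with h2 | h2
    · exact absurd (smul_left_cancel _ (h2.trans h1.symm)) hh
    · exact .inl ⟨hmem _ _ h1, hmem _ _ h2⟩
    · exact .inr ⟨hmem _ _ h1, hmem _ _ h2⟩
    · exact absurd (smul_left_cancel _ (h2.trans h1.symm)) hh

theorem card_fixed_eq_four (hc : Nat.card V = 16) {b : Equiv.Perm V}
    (hb : Subgroup.zpowers b ≤ additivePerm V) (hb3 : b ^ 3 = 1) (hb1 : b ≠ 1) {v : V}
    (hv : v ≠ 0) (hbv : b v = v) :
    Nat.card (fixedAddSubgroup (Subgroup.zpowers b) hb) = 4 := by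
  have := Fact.mk Nat.prime_three
  have h1 := card_modEq_card_fixedAddSubgroup (q := 3) hb (by
    rintro _ ⟨i, rfl⟩
    change (b ^ i) ^ 3 = 1
    rw [← zpow_natCast, zpow_comm, zpow_natCast, hb3, one_zpow])
  rw [hc] at h1
  have h2 := AddSubgroup.card_addSubgroup_dvd_card (fixedAddSubgroup (Subgroup.zpowers b) hb)
  rw [hc] at h2
  rcases Nat.eq_one_or_four_or_sixteen h2 h1 with h | h | h
  · have h3 := (mem_fixedAddSubgroup_zpowers hb).2 hbv
    rw [AddSubgroup.card_eq_one.1 h] at h3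
    exact absurd h3 hv
  · exact h
  · have h3 := AddSubgroup.eq_top_of_card_eq _ (h.trans hc.symm)
    refine absurd ?_ hb1
    ext u
    exact (mem_fixedAddSubgroup_zpowers hb).1 (h3 ▸ AddSubgroup.mem_top u)

theorem AddSubgroup.exists_add_eq {U W : AddSubgroup V} (h : U ⊓ W = ⊥)
    (hc : Nat.card V = Nat.card U * Nat.card W) (v : V) : ∃ u ∈ U, ∃ w ∈ W, u + w = v := by
  have hinj : Function.Injective fun x : U × W => (x.1 + x.2 : V) := by
    rintro ⟨u, w⟩ ⟨u', w'⟩ huw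
    simp only at huw
    have h1 : (u - u' : V) = w' - w := by
      rw [sub_eq_sub_iff_add_eq_add, huw, add_comm]
    have h2 : (u - u' : V) ∈ U ⊓ W := ⟨U.sub_mem u.2 u'.2, h1 ▸ W.sub_mem w'.2 w.2⟩
    rw [h, AddSubgroup.mem_bot] at h2
    rw [h2] at h1
    exact Prod.ext (Subtype.ext (sub_eq_zero.1 h2)) (Subtype.ext (sub_eq_zero.1 h1.symm).symm)
  obtain ⟨x, hx⟩ := (hinj.bijective_of_nat_card_le (by rw [hc, Nat.card_prod])).2 v
  exact ⟨x.1, x.1.2, x.2, x.2.2, hx⟩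

theorem IsSolvableLinear.preservesDecomposition_of_fixed (hH : IsSolvableLinear H)
    (hc : Nat.card V = 16) {A : Subgroup (Equiv.Perm V)} (hAH : A ≤ H)
    (hAn : ∀ h ∈ H, ∀ m ∈ A, h * m * h⁻¹ ∈ A) (hAc : ∀ x ∈ A, ∀ y ∈ A, x * y = y * x)
    (hA3 : ∀ x ∈ A, x ^ 3 = 1) (hA0 : ∀ v, (∀ a ∈ A, a v = v) → v = 0)
    {b : Equiv.Perm V} (hb : b ∈ A) (hb1 : b ≠ 1) {v : V} (hv : v ≠ 0) (hbv : b v = v) :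
    PreservesDecomposition H := by
  have := Fact.mk Nat.prime_three
  let _ := distribMulActionOfLe hH.le
  have hA := hAH.trans hH.le
  have hz : ∀ a ∈ A, Subgroup.zpowers a ≤ A := fun a ha => by rwa [Subgroup.zpowers_le]
  have hbz := (hz b hb).trans hA
  obtain ⟨U, hmemU, hU4⟩ : ∃ U : AddSubgroup V, (∀ u, u ∈ U ↔ b u = u) ∧ Nat.card U = 4 :=
    ⟨_, fun u => mem_fixedAddSubgroup_zpowers hbz, card_fixed_eq_four hc hbz (hA3 b hb) hb1 hv hbv⟩
  have hmem : ∀ (h : H) (u : V),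
      u ∈ h • U ↔ ((h : Equiv.Perm V) * b * (h : Equiv.Perm V)⁻¹) u = u := by
    intro h u
    rw [AddSubgroup.mem_pointwise_smul_iff_inv_smul_mem, hmemU, Equiv.Perm.mul_apply,
      Equiv.Perm.mul_apply]
    exact Equiv.Perm.eq_inv_iff_eq
  have hcard : ∀ h : H, Nat.card (h • U : AddSubgroup V) = 4 := fun h => by
    rw [AddSubgroup.natCard_smul, hU4]
  have hinv : ∀ (h : H), ∀ a ∈ A, ∀ w ∈ h • U, a w ∈ h • U := fun h a ha w hw => by
    rw [hmem] at hw ⊢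
    have h1 := congrArg (· w) (hAc _ (hAn h h.2 b hb) a ha)
    simp only [Equiv.Perm.mul_apply] at h1 hw ⊢
    rw [h1, hw]
  have hdisj : ∀ h k : H, h • U ≠ k • U → h • U ⊓ k • U = ⊥ := fun h k hhk => by
    have h1 := card_modEq_card_inf_fixedAddSubgroup hA hA3 (h • U ⊓ k • U)
      fun a ha w hw => ⟨hinv h a ha w hw.1, hinv k a ha w hw.2⟩
    have hF : fixedAddSubgroup A hA = ⊥ := by
      rw [eq_bot_iff]
      exact fun w hw => hA0 w hw
    rw [hF, inf_bot_eq, AddSubgroup.card_bot] at h1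
    have h2 := AddSubgroup.card_addSubgroup_dvd_card (h • U ⊓ k • U)
    rw [hc] at h2
    have h3 := AddSubgroup.card_le_of_le (inf_le_left : h • U ⊓ k • U ≤ h • U)
    rw [hcard] at h3
    rcases Nat.eq_one_or_four_or_sixteen h2 (h1.trans (by rfl : 1 ≡ 16 [MOD 3])).symm
      with h4 | h4 | h4
    · exact AddSubgroup.card_eq_one.1 h4
    · refine absurd ?_ hhk
      have h5 := AddSubgroup.eq_of_le_of_card_ge (inf_le_left : h • U ⊓ k • U ≤ h • U)
        (by rw [hcard, h4])
      have h6 := AddSubgroup.eq_of_le_of_card_ge (inf_le_right : h • U ⊓ k • U ≤ k • U)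
        (by rw [hcard, h4])
      rw [← h5, h6]
    · omega
  have hdisj' : ∀ h : H, h • U ≠ U → U ⊓ h • U = ⊥ := fun h hh => by
    simpa using hdisj 1 h (by simpa using hh.symm)
  refine hH.preservesDecomposition_of_orbit hc hU4 hdisj' ?_
  obtain ⟨h, hh⟩ : ∃ h : H, h • U ≠ U := hH.exists_smul_ne hc hU4
  have hsum := AddSubgroup.exists_add_eq (hdisj' h hh) (by rw [hcard, hU4, hc])
  have hsub : MulAction.orbit H U ⊆ {U, h • U} := by
    rintro _ ⟨k, rfl⟩
    by_contra hk
    simp only [Set.mem_insert_iff, Set.mem_singleton_iff, not_or] at hk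
    obtain ⟨⟨w, hw⟩, hw0⟩ := (AddSubgroup.ne_bot_iff_exists_ne_zero (H := k • U)).1 fun h0 => by
      have := hcard k
      rw [h0, AddSubgroup.card_bot] at this
      omega
    obtain ⟨u, hu, u', hu', rfl⟩ := hsum w
    obtain ⟨c, hcA, hcU⟩ : ∃ c ∈ A, ∀ w, w ∈ k • U ↔ c w = w := ⟨_, hAn k k.2 b hb, hmem k⟩
    have hcu : c u ∈ U := by simpa using hinv 1 c hcA u (by simpa using hu)
    have h1 := (hcU _).1 hw
    rw [map_add_of_mem (hA hcA)] at h1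
    have h2 : c u - u = u' - c u' := by
      rw [sub_eq_sub_iff_add_eq_add, h1, add_comm]
    have h3 : c u - u ∈ U ⊓ h • U :=
      ⟨U.sub_mem hcu hu, h2 ▸ (h • U).sub_mem hu' (hinv h c hcA u' hu')⟩
    rw [hdisj' h hh, AddSubgroup.mem_bot, sub_eq_zero] at h3
    have h4 : u ∈ U ⊓ k • U := ⟨hu, (hcU u).2 h3⟩
    rw [hdisj' k hk.1, AddSubgroup.mem_bot] at h4
    subst h4
    have h5 : 0 + u' ∈ k • U ⊓ h • U := ⟨hw, by rwa [zero_add]⟩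
    rw [hdisj k h hk.2, AddSubgroup.mem_bot] at h5
    exact hw0 (Subtype.ext h5)
  exact (Set.ncard_le_ncard hsub (Set.toFinite _)).trans (Set.ncard_pair hh.symm).le

end Decomposition

section Lines

variable {V : Type*} [AddCommGroup V] {a : Equiv.Perm V}

/-- An additive permutation satisfying `a² = 1 + a` in characteristic two: the multiplication by a
generator of the field with four elements. -/
structure IsCubic (a : Equiv.Perm V) : Prop where
  mem : a ∈ additivePerm V
  add_self : ∀ v : V, v + v = 0
  apply_apply : ∀ v, a (a v) = v + a v

namespace IsCubic

theorem add_add (ha : IsCubic a) (v w : V) : v + (v + w) = w := by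
  rw [← add_assoc, ha.add_self, zero_add]

theorem neg_eq (ha : IsCubic a) (v : V) : -v = v := neg_eq_of_add_eq_zero_left (ha.add_self v)

theorem pow_three (ha : IsCubic a) : a ^ 3 = 1 := by
  ext v
  change a (a (a v)) = v
  rw [ha.apply_apply, ha.apply_apply, add_comm v, ha.add_add]

theorem eq_zero (ha : IsCubic a) {v : V} (hv : a v = v) : v = 0 := by
  have := ha.apply_apply v
  rwa [hv, hv, ha.add_self] at this

/-- The line over the field with four elements spanned by a vector. -/
def line (ha : IsCubic a) (v : V) : AddSubgroup V where
  carrier := {u | u = 0 ∨ u = v ∨ u = a v ∨ u = v + a v}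
  zero_mem' := .inl rfl
  add_mem' := by
    have h1 : a v + (v + a v) = v := by rw [add_comm v, ha.add_add]
    have h2 : v + a v + v = a v := by rw [add_comm, ha.add_add]
    have h3 : v + a v + a v = v := by rw [add_comm, h1]
    rintro x y (hx | hx | hx | hx) (hy | hy | hy | hy) <;> rw [Set.mem_ofPred_eq, hx, hy] <;>
      simp only [ha.add_self, ha.add_add, add_comm (a v) v, h1, h2, h3, add_zero, zero_add,
        true_or, or_true]
  neg_mem' := by
    rintro _ (rfl | rfl | rfl | rfl) <;> simp [ha.neg_eq]

theorem self_mem_line (ha : IsCubic a) (v : V) : v ∈ ha.line v := .inr (.inl rfl)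

theorem apply_mem_line (ha : IsCubic a) {u v : V} (hu : u ∈ ha.line v) : a u ∈ ha.line v := by
  rcases hu with rfl | rfl | rfl | rfl
  · rw [map_zero_of_mem ha.mem]
    exact zero_mem _
  · exact .inr (.inr (.inl rfl))
  · exact .inr (.inr (.inr (ha.apply_apply _)))
  · refine .inr (.inl ?_)
    rw [map_add_of_mem ha.mem, ha.apply_apply, add_comm v, ha.add_add]

theorem pow_apply_mem_line (ha : IsCubic a) {u v : V} (hu : u ∈ ha.line v) (k : ℕ) :
    (a ^ k) u ∈ ha.line v := by
  induction k with
  | zero => exact hu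
  | succ k ih =>
    rw [pow_succ', Equiv.Perm.mul_apply]
    exact ha.apply_mem_line ih

theorem exists_pow_of_mem_line (ha : IsCubic a) {u v : V} (hu : u ∈ ha.line v) (hu0 : u ≠ 0) :
    ∃ k : ℕ, u = (a ^ k) v := by
  rcases hu with rfl | rfl | rfl | rfl
  · exact absurd rfl hu0
  · exact ⟨0, rfl⟩
  · exact ⟨1, rfl⟩
  · exact ⟨2, (ha.apply_apply v).symm⟩

theorem line_le_of_mem (ha : IsCubic a) {u v : V} (hu : u ∈ ha.line v) : ha.line u ≤ ha.line v := by
  rintro _ (rfl | rfl | rfl | rfl)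
  · exact zero_mem _
  · exact hu
  · exact ha.apply_mem_line hu
  · exact add_mem hu (ha.apply_mem_line hu)

theorem line_eq_of_mem (ha : IsCubic a) {u v : V} (hu : u ∈ ha.line v) (hu0 : u ≠ 0) :
    ha.line u = ha.line v := by
  refine (ha.line_le_of_mem hu).antisymm (ha.line_le_of_mem ?_)
  rcases hu with rfl | rfl | rfl | rfl
  · exact absurd rfl hu0
  · exact ha.self_mem_line _
  · refine .inr (.inr (.inr ?_))
    rw [ha.apply_apply, add_comm v, ha.add_add]
  · refine .inr (.inr (.inl ?_))
    rw [map_add_of_mem ha.mem, ha.apply_apply, add_comm v, ha.add_add]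

theorem line_inf_line (ha : IsCubic a) {u v : V} (h : ha.line u ≠ ha.line v) :
    ha.line u ⊓ ha.line v = ⊥ := by
  rw [eq_bot_iff]
  intro w hw
  by_contra hw0
  exact h ((ha.line_eq_of_mem hw.1 hw0).symm.trans (ha.line_eq_of_mem hw.2 hw0))

theorem card_line (ha : IsCubic a) {v : V} (hv : v ≠ 0) : Nat.card (ha.line v) = 4 := by
  have h1 : a v ≠ v := fun h => hv (ha.eq_zero h)
  have h0 : a v ≠ 0 := fun h => hv (a.injective (h.trans (map_zero_of_mem ha.mem).symm))
  have h : ((ha.line v : AddSubgroup V) : Set V) = {0, v, a v, v + a v} := rfl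
  change ((ha.line v : AddSubgroup V) : Set V).ncard = 4
  have h2 : v + a v ≠ 0 := fun h => h1 (by rw [← neg_eq_of_add_eq_zero_right h, ha.neg_eq])
  rw [h, Set.ncard_insert_of_notMem, Set.ncard_insert_of_notMem, Set.ncard_pair]
  · simpa using hv
  · simp [h1.symm, h0]
  · simp [hv.symm, h0.symm, h2.symm]

/-- The set of lines. -/
def lines (ha : IsCubic a) : Set (AddSubgroup V) := ha.line '' {v | v ≠ 0}

theorem three_mul_ncard_lines [Finite V] (ha : IsCubic a) :
    3 * ha.lines.ncard = Nat.card V - 1 := by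
  have h1 : Nat.card {v : V // v ≠ 0} = Nat.card V - 1 := by
    have := Fintype.ofFinite V
    classical
    rw [Nat.card_eq_fintype_card, Nat.card_eq_fintype_card, Fintype.card_subtype_compl,
      Fintype.card_subtype_eq]
  let f : {v : V // v ≠ 0} → ha.lines := fun v => ⟨ha.line v, v, v.2, rfl⟩
  have := Fintype.ofFinite ha.lines
  rw [← h1, ← Nat.card_congr (Equiv.sigmaFiberEquiv f), Nat.card_sigma, ← Nat.card_coe_set_eq,
    mul_comm]
  have hfib : ∀ l : ha.lines, Nat.card {v // f v = l} = 3 := by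
    rintro ⟨_, v, hv, rfl⟩
    have e : {w // f w = ⟨ha.line v, v, hv, rfl⟩} ≃ ((ha.line v : Set V) \ {0} : Set V) :=
      { toFun := fun w => ⟨w.1, by
          have := congrArg Subtype.val w.2
          change ha.line w.1.1 = ha.line v at this
          change (w.1.1 : V) ∈ ha.line v
          exact (SetLike.ext_iff.1 this _).1 (ha.self_mem_line w.1.1), w.1.2⟩
        invFun := fun w => ⟨⟨w, w.2.2⟩, Subtype.ext (ha.line_eq_of_mem w.2.1 w.2.2)⟩
        left_inv := fun _ => rfl
        right_inv := fun _ => rfl }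
    rw [Nat.card_congr e, Nat.card_coe_set_eq,
      Set.ncard_sdiff_singleton_of_mem (zero_mem (ha.line v))]
    have := ha.card_line hv
    rw [← SetLike.coe_sort_coe, Nat.card_coe_set_eq] at this
    rw [this]
  rw [Finset.sum_congr rfl fun l _ => hfib l, Finset.sum_const, Finset.card_univ,
    Nat.card_eq_fintype_card, smul_eq_mul]

theorem apply_mem_line_apply (ha : IsCubic a) {h : Equiv.Perm V} (hh : h ∈ additivePerm V) {k : ℕ}
    (hk : h * a = a ^ k * h) {u v : V} (hu : u ∈ ha.line v) : h u ∈ ha.line (h v) := by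
  have hav : h (a v) ∈ ha.line (h v) := by
    have := congrArg (· v) hk
    simp only [Equiv.Perm.mul_apply] at this
    rw [this]
    exact ha.pow_apply_mem_line (ha.self_mem_line _) k
  rcases hu with rfl | rfl | rfl | rfl
  · rw [map_zero_of_mem hh]
    exact zero_mem _
  · exact ha.self_mem_line _
  · exact hav
  · rw [map_add_of_mem hh]
    exact add_mem (ha.self_mem_line _) hav

theorem pow_eq_of_apply_eq (ha : IsCubic a) {v : V} (hv : v ≠ 0) {i k : ℕ}
    (h : (a ^ i) v = (a ^ k) v) : a ^ i = a ^ k := by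
  have h1 : a v ≠ v := fun h => hv (ha.eq_zero h)
  have h2 : v + a v ≠ v := fun h => hv (a.injective (by
    rw [add_eq_left.1 h, map_zero_of_mem ha.mem]))
  have h3 : v + a v ≠ a v := fun h => hv (add_eq_right.1 h)
  have hsq : ∀ u, (a ^ 2) u = u + a u := fun u => ha.apply_apply u
  rw [pow_eq_pow_mod i ha.pow_three, pow_eq_pow_mod k ha.pow_three] at h ⊢
  have hi := Nat.mod_lt i three_pos
  have hk := Nat.mod_lt k three_pos
  generalize i % 3 = i at *
  generalize k % 3 = k at *
  interval_cases i <;> interval_cases k <;>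
    simp only [pow_zero, pow_one, hsq, Equiv.Perm.one_apply] at h ⊢ <;>
    first
    | exact absurd h h1
    | exact absurd h h2
    | exact absurd h h3
    | exact absurd h.symm h1
    | exact absurd h.symm h2
    | exact absurd h.symm h3

/-- An additive permutation preserving every line is a scalar. -/
theorem exists_eq_pow (ha : IsCubic a) [Finite V] (hc : 4 < Nat.card V) {h : Equiv.Perm V}
    (hh : h ∈ additivePerm V) (hl : ∀ v, h v ∈ ha.line v) : ∃ k : ℕ, h = a ^ k := by
  have hpow : ∀ v, v ≠ 0 → ∃ k : ℕ, h v = (a ^ k) v := fun v hv =>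
    ha.exists_pow_of_mem_line (hl v)
      fun h0 => hv (h.injective (h0.trans (map_zero_of_mem hh).symm))
  have hmem : ∀ k : ℕ, a ^ k ∈ additivePerm V := fun k => pow_mem ha.mem k
  have hindep : ∀ v w, v ≠ 0 → w ∉ ha.line v → ∀ k : ℕ, h v = (a ^ k) v → h w = (a ^ k) w := by
    intro v w hv hw k hk
    have hw0 : w ≠ 0 := by
      rintro rfl
      exact hw (zero_mem _)
    have hvw : v + w ≠ 0 := fun h0 => hw (by
      rw [← neg_eq_of_add_eq_zero_right h0, ha.neg_eq]
      exact ha.self_mem_line v)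
    obtain ⟨j, hj⟩ := hpow w hw0
    obtain ⟨i, hi⟩ := hpow (v + w) hvw
    rw [map_add_of_mem hh, map_add_of_mem (hmem i), hk, hj] at hi
    have h1 : (a ^ k) v - (a ^ i) v = (a ^ i) w - (a ^ j) w := by
      rw [sub_eq_sub_iff_add_eq_add, hi, add_comm]
    have hne : ha.line v ≠ ha.line w := fun h0 => hw (h0 ▸ ha.self_mem_line w)
    have h2 : (a ^ k) v - (a ^ i) v ∈ ha.line v ⊓ ha.line w :=
      ⟨(ha.line v).sub_mem (ha.pow_apply_mem_line (ha.self_mem_line v) k)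
        (ha.pow_apply_mem_line (ha.self_mem_line v) i),
      h1 ▸ (ha.line w).sub_mem (ha.pow_apply_mem_line (ha.self_mem_line w) i)
        (ha.pow_apply_mem_line (ha.self_mem_line w) j)⟩
    rw [ha.line_inf_line hne, AddSubgroup.mem_bot] at h2
    have h3 := ha.pow_eq_of_apply_eq hv (sub_eq_zero.1 h2)
    rw [h2] at h1
    rw [hj, ← sub_eq_zero.1 h1.symm, h3]
  obtain ⟨v, hv⟩ : ∃ v : V, v ≠ 0 := by
    have : Nontrivial V := Finite.one_lt_card_iff_nontrivial.1 (by omega)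
    exact exists_ne 0
  obtain ⟨w, hw⟩ : ∃ w, w ∉ ha.line v := by
    by_contra! hall
    have := ha.card_line hv
    rw [(AddSubgroup.eq_top_iff' _).2 hall, AddSubgroup.card_top] at this
    omega
  obtain ⟨k, hk⟩ := hpow v hv
  refine ⟨k, Equiv.ext fun u => ?_⟩
  by_cases hu : u ∈ ha.line v
  · by_cases hu0 : u = 0
    · rw [hu0, map_zero_of_mem hh, map_zero_of_mem (hmem k)]
    · refine hindep w u ?_ (fun hu' => hw ?_) k (hindep v w hv hw k hk)
      · rintro rfl
        exact hw (zero_mem _)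
      · rw [← ha.line_eq_of_mem hu hu0, ha.line_eq_of_mem hu' hu0]
        exact ha.self_mem_line w
  · exact hindep v u hv hu k hk

end IsCubic

end Lines

section Dichotomy

variable {V : Type*} [AddCommGroup V] [Finite V] {H : Subgroup (Equiv.Perm V)}

theorem IsCubic.smul_line {a : Equiv.Perm V} (ha : IsCubic a) (hle : H ≤ additivePerm V)
    (hn : ∀ h ∈ H, ∃ k : ℕ, h * a = a ^ k * h) {v : V} (hv : v ≠ 0) (h : H) :
    letI := distribMulActionOfLe hle
    h • ha.line v = ha.line ((h : Equiv.Perm V) v) := by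
  let _ := distribMulActionOfLe hle
  change h • ha.line v = ha.line ((h : Equiv.Perm V) v)
  obtain ⟨k, hk⟩ := hn h h.2
  refine AddSubgroup.eq_of_le_of_card_ge ?_ ?_
  · intro w hw
    obtain ⟨u, hu, rfl⟩ := AddSubgroup.mem_smul_pointwise_iff_exists _ _ _ |>.1 hw
    exact ha.apply_mem_line_apply (hle h.2) hk hu
  · rw [AddSubgroup.natCard_smul, ha.card_line hv, ha.card_line]
    exact fun h0 => hv (h.1.injective (h0.trans (map_zero_of_mem (hle h.2)).symm))

/-- A transitive solvable group of prime degree `5` contains a normal subgroup of order `5`. -/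
theorem exists_normal_zpowers_of_card_eq_five {Λ : Type*} (hΛ : Nat.card Λ = 5)
    (R : Subgroup (Equiv.Perm Λ)) [Group.IsSolvable R] [MulAction.IsPretransitive R Λ] :
    ∃ m ∈ R, m ≠ 1 ∧ m ^ 5 = 1 ∧ ∀ g ∈ R, g * m * g⁻¹ ∈ Subgroup.zpowers m := by
  have : Finite Λ := Nat.finite_of_card_ne_zero (by omega)
  have : Nontrivial Λ := Finite.one_lt_card_iff_nontrivial.1 (by omega)
  have := MulAction.IsPreprimitive.of_prime_card (G := R) (X := Λ) (hΛ ▸ Nat.prime_five)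
  obtain ⟨p, hp, M, hMR, hMn, hMc, hMp, hMt, hMf⟩ := exists_regular_normal_subgroup R
  obtain ⟨x, y, hxy⟩ := exists_pair_ne Λ
  obtain ⟨m, hm, hmxy⟩ := hMt x y
  have hm1 : m ≠ 1 := by
    rintro rfl
    exact hxy hmxy
  have hM : Nat.card M = 5 := by
    rw [← hΛ]
    refine Nat.card_eq_of_bijective (fun m : M => m.1 x) ⟨fun m n hmn => ?_, fun z => ?_⟩
    · have h1 := hMf (n.1⁻¹ * m.1) (M.mul_mem (M.inv_mem n.2) m.2) x (by
        rw [Equiv.Perm.mul_apply, Equiv.Perm.inv_eq_iff_eq]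
        exact hmn)
      exact Subtype.ext (inv_mul_eq_one.1 h1).symm
    · obtain ⟨n, hn, h⟩ := hMt x z
      exact ⟨⟨n, hn⟩, h⟩
  have hord : orderOf m = 5 := by
    have h1 : orderOf m ∣ 5 := by
      rw [← hM]
      exact Subgroup.orderOf_dvd_natCard M hm
    exact ((Nat.dvd_prime Nat.prime_five).1 h1).resolve_left (by rwa [orderOf_eq_one_iff])
  have hMz : Subgroup.zpowers m = M :=
    Subgroup.eq_of_le_of_card_ge (by rwa [Subgroup.zpowers_le]) (by rw [Nat.card_zpowers, hord, hM])
  refine ⟨m, hMR hm, hm1, hord ▸ pow_orderOf_eq_one m, fun g hg => ?_⟩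
  rw [hMz]
  exact hMn g hg m hm

theorem IsSolvableLinear.exists_quintic_of_lines (hH : IsSolvableLinear H) (hc : Nat.card V = 16)
    {a : Equiv.Perm V} (ha : IsCubic a) (hn : ∀ h ∈ H, ∃ k : ℕ, h * a = a ^ k * h)
    (htr : ∀ u v : V, u ≠ 0 → v ≠ 0 → ∃ h ∈ H, ha.line (h u) = ha.line v) :
    ∃ x ∈ H, x ^ 5 = 1 ∧ x ≠ 1 ∧ ∀ h ∈ H, ∃ k : ℕ, h * x = x ^ k * h := by
  let _ := distribMulActionOfLe hH.le
  have hsm : ∀ (h : H) (v : V), v ≠ 0 → h • ha.line v = ha.line ((h : Equiv.Perm V) v) :=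
    fun h v hv => ha.smul_line hH.le hn hv h
  have hne : ∀ (h : H) (v : V), v ≠ 0 → (h : Equiv.Perm V) v ≠ 0 := fun h v hv h0 =>
    hv (h.1.injective (h0.trans (map_zero_of_mem (hH.le h.2)).symm))
  let Λ : SubMulAction H (AddSubgroup V) :=
    { carrier := ha.lines
      smul_mem' := by
        rintro h _ ⟨v, hv, rfl⟩
        rw [hsm h v hv]
        exact ⟨_, hne h v hv, rfl⟩ }
  have hΛ : Nat.card Λ = 5 := by
    have h1 := ha.three_mul_ncard_lines
    have h2 : Nat.card Λ = ha.lines.ncard := rfl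
    omega
  let φ : H →* Equiv.Perm Λ := MulAction.toPermHom H Λ
  have hφ : ∀ (h : H) (v : V) (hv : v ≠ 0),
      (φ h ⟨ha.line v, v, hv, rfl⟩ : AddSubgroup V) = ha.line ((h : Equiv.Perm V) v) :=
    fun h v hv => hsm h v hv
  have := hH.isSolvable
  have : Group.IsSolvable φ.range := Group.isSolvable_of_surjective φ.rangeRestrict_surjective
  have : MulAction.IsPretransitive φ.range Λ := by
    refine ⟨?_⟩
    rintro ⟨_, u, hu, rfl⟩ ⟨_, v, hv, rfl⟩
    obtain ⟨h, hh, huv⟩ := htr u v hu hv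
    exact ⟨⟨φ ⟨h, hh⟩, _, rfl⟩, Subtype.ext ((hφ ⟨h, hh⟩ u hu).trans huv)⟩
  have hker : ∀ h : H, φ h = 1 → ∃ k : ℕ, (h : Equiv.Perm V) = a ^ k := fun h h1 => by
    refine ha.exists_eq_pow (by omega) (hH.le h.2) fun v => ?_
    by_cases hv : v = 0
    · rw [hv, map_zero_of_mem (hH.le h.2)]
      exact zero_mem _
    · have := hφ h v hv
      rw [h1] at this
      change ha.line v = _ at this
      rw [this]
      exact ha.self_mem_line _
  obtain ⟨_, ⟨n, rfl⟩, hm1, hm5, hmn⟩ := exists_normal_zpowers_of_card_eq_five hΛ φ.range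
  obtain ⟨i, hi⟩ := hker (n ^ 5) (by rw [map_pow, hm5])
  obtain ⟨k, hk⟩ := hn n n.2
  have hi' : (n : Equiv.Perm V) ^ 5 = a ^ i := hi
  have hcomm : Commute (n : Equiv.Perm V) a := by
    have h1 := pow_mul_of_mul_eq hk 5
    rw [hi', ← pow_succ, pow_succ', mul_left_inj] at h1
    have hord : orderOf a = 3 := by
      have := Fact.mk Nat.prime_three
      refine orderOf_eq_prime ha.pow_three ?_
      rintro rfl
      obtain ⟨v, hv⟩ : ∃ v : V, v ≠ 0 := by
        have : Nontrivial V := Finite.one_lt_card_iff_nontrivial.1 (by omega)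
        exact exists_ne 0
      exact hv (ha.eq_zero rfl)
    have h2 : 1 ≡ k ^ 5 [MOD 3] := by
      rw [← hord, ← pow_eq_pow_iff_modEq, pow_one]
      exact h1
    have h3 : k % 3 = 1 := by
      have h4 : 1 % 3 = (k % 3) ^ 5 % 3 := by rw [← Nat.pow_mod]; exact h2
      have h5 : ∀ j < 3, 1 % 3 = j ^ 5 % 3 → j = 1 := by decide
      exact h5 _ (Nat.mod_lt k three_pos) h4
    rw [pow_eq_pow_mod k ha.pow_three, h3, pow_one] at hk
    exact hk
  refine ⟨(n : Equiv.Perm V) ^ 3, H.pow_mem n.2 3, ?_, fun h3 => ?_, fun h hh => ?_⟩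
  · rw [← pow_mul, mul_comm, pow_mul, hi', ← pow_mul, mul_comm, pow_mul, ha.pow_three, one_pow]
  · have h4 : φ n ^ 3 = 1 := by
      rw [← map_pow, show n ^ 3 = 1 from Subtype.ext h3, map_one]
    apply hm1
    have h5 : φ n ^ 5 = φ n ^ 3 * φ n ^ 2 := by rw [← pow_add]
    have h6 : φ n ^ 3 = φ n ^ 2 * φ n := pow_succ _ _
    rw [hm5, h4, one_mul] at h5
    rw [h4, ← h5, one_mul] at h6
    exact h6.symm
  · obtain ⟨j, hj⟩ := exists_mul_eq_pow_mul (hmn (φ ⟨h, hh⟩) ⟨_, rfl⟩)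
    obtain ⟨l, hl⟩ := hker ((⟨h, hh⟩ : H) * n * (⟨h, hh⟩ : H)⁻¹ * (n ^ j)⁻¹) (by
      rw [map_mul, map_mul, map_mul, map_inv, map_inv, map_pow, hj]
      group)
    have hl' : h * n * h⁻¹ * ((n : Equiv.Perm V) ^ j)⁻¹ = a ^ l := hl
    have h1 : h * n * h⁻¹ = a ^ l * (n : Equiv.Perm V) ^ j := by
      rw [← hl', inv_mul_cancel_right]
    refine ⟨j, ?_⟩
    have h2 : h * (n : Equiv.Perm V) ^ 3 * h⁻¹ = ((n : Equiv.Perm V) ^ 3) ^ j := by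
      rw [← conj_pow, h1, ((hcomm.pow_pow j l).symm).mul_pow, ← pow_mul, mul_comm l, pow_mul,
        ha.pow_three, one_pow, one_mul, ← pow_mul, mul_comm, pow_mul]
    rw [← h2, inv_mul_cancel_right]

theorem IsSolvableLinear.preservesDecomposition_of_lines (hH : IsSolvableLinear H)
    (hc : Nat.card V = 16) {a : Equiv.Perm V} (ha : IsCubic a)
    (hn : ∀ h ∈ H, ∃ k : ℕ, h * a = a ^ k * h) {u v : V} (hu : u ≠ 0) (hv : v ≠ 0)
    (huv : ∀ h ∈ H, ha.line (h u) ≠ ha.line v) : PreservesDecomposition H := by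
  let _ := distribMulActionOfLe hH.le
  have hsm : ∀ (h : H) (v : V), v ≠ 0 → h • ha.line v = ha.line ((h : Equiv.Perm V) v) :=
    fun h v hv => ha.smul_line hH.le hn hv h
  have hne : ∀ (h : H) (v : V), v ≠ 0 → (h : Equiv.Perm V) v ≠ 0 := fun h v hv h0 =>
    hv (h.1.injective (h0.trans (map_zero_of_mem (hH.le h.2)).symm))
  have key : ∀ w : V, w ≠ 0 → (MulAction.orbit H (ha.line w)).ncard ≤ 2 →
      PreservesDecomposition H := fun w hw horb => by
    refine hH.preservesDecomposition_of_orbit hc (ha.card_line hw) (fun h hh => ?_) horb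
    change ha.line w ⊓ h • ha.line w = ⊥
    change h • ha.line w ≠ ha.line w at hh
    rw [hsm h w hw] at hh ⊢
    exact ha.line_inf_line hh.symm
  have hsub : ∀ w : V, w ≠ 0 → MulAction.orbit H (ha.line w) ⊆ ha.lines := by
    rintro w hw _ ⟨h, rfl⟩
    change h • ha.line w ∈ _
    rw [hsm h w hw]
    exact ⟨_, hne h w hw, rfl⟩
  have hdisj : Disjoint (MulAction.orbit H (ha.line u)) (MulAction.orbit H (ha.line v)) := by
    refine (MulAction.orbit.eq_or_disjoint _ _).resolve_left fun h => ?_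
    obtain ⟨g, hg⟩ : ha.line v ∈ MulAction.orbit H (ha.line u) :=
      h ▸ MulAction.mem_orbit_self _
    exact huv g g.2 ((hsm g u hu).symm.trans hg)
  have h1 := ha.three_mul_ncard_lines
  have h2 := Set.ncard_le_ncard (Set.union_subset (hsub u hu) (hsub v hv)) (Set.toFinite _)
  rw [Set.ncard_union_eq hdisj (Set.toFinite _) (Set.toFinite _)] at h2
  by_cases h3 : (MulAction.orbit H (ha.line u)).ncard ≤ 2
  · exact key u hu h3
  · exact key v hv (by omega)

theorem IsSolvableLinear.exists_quintic_or_preservesDecomposition (hH : IsSolvableLinear H)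
    (hc : Nat.card V = 16) :
    (∃ x ∈ H, x ^ 5 = 1 ∧ x ≠ 1 ∧ ∀ h ∈ H, ∃ k : ℕ, h * x = x ^ k * h) ∨
      PreservesDecomposition H := by
  obtain ⟨q, hq, A, hAH, hA1, hAn, hAc, hAq, hA0, hqc⟩ := hH.exists_normal (by omega)
  have hA := hAH.trans hH.le
  have hq' : q = 3 ∨ q = 5 := by
    rw [hc] at hqc
    have h1 : q ∣ 3 * 5 := (Nat.modEq_iff_dvd' (by norm_num)).1 hqc.symm
    rcases (Nat.Prime.dvd_mul hq).1 h1 with h | h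
    · exact .inl ((Nat.prime_dvd_prime_iff_eq hq Nat.prime_three).1 h)
    · exact .inr ((Nat.prime_dvd_prime_iff_eq hq Nat.prime_five).1 h)
  have := Fact.mk hq
  have hcyc : (∀ b ∈ A, ∀ v, v ≠ 0 → b v = v → b = 1) → ∃ a ∈ A, a ≠ 1 ∧
      ∀ h ∈ H, ∃ k : ℕ, h * a = a ^ k * h := fun hfree => by
    obtain ⟨a, ha, ha1, rfl⟩ := exists_eq_zpowers_of_free hA hA1 hAq
      (by rw [hc]; rcases hq' with rfl | rfl <;> norm_num) hfree
    exact ⟨a, ha, ha1, fun h hh => exists_mul_eq_pow_mul (hAn h hh a ha)⟩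
  rcases hq' with rfl | rfl
  · by_cases hfree : ∀ b ∈ A, ∀ v, v ≠ 0 → b v = v → b = 1
    · obtain ⟨a, ha, ha1, hn⟩ := hcyc hfree
      have hcub : IsCubic a := by
        refine ⟨hA ha, hH.add_self, fun v => ?_⟩
        have h3 : a (a (a v)) = v := congrArg (· v) (hAq a ha)
        have h4 : v + a v + a (a v) = 0 := by
          by_contra h0
          refine ha1 (hfree a ha _ h0 ?_)
          rw [map_add_of_mem (hA ha), map_add_of_mem (hA ha), h3]
          abel
        rw [← neg_eq_of_add_eq_zero_right h4]
        exact neg_eq_of_add_eq_zero_left (hH.add_self _)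
      by_cases htr : ∀ u v : V, u ≠ 0 → v ≠ 0 → ∃ h ∈ H, hcub.line (h u) = hcub.line v
      · exact .inl (hH.exists_quintic_of_lines hc hcub hn htr)
      · push Not at htr
        obtain ⟨u, v, hu, hv, huv⟩ := htr
        exact .inr (hH.preservesDecomposition_of_lines hc hcub hn hu hv huv)
    · push Not at hfree
      obtain ⟨b, hb, v, hv, hbv, hb1⟩ := hfree
      exact .inr (hH.preservesDecomposition_of_fixed hc hAH hAn hAc hAq hA0 hb hb1 hv hbv)
  · left
    obtain ⟨a, ha, ha1, hn⟩ := hcyc fun b hb v hv hbv => by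
      by_contra hb1
      refine hv (fixes_eq_zero_of_card (hA hb) (hAq b hb) hb1 ?_ hbv)
      rw [hc]
      intro d hd hm
      have h1 : ∀ d ≤ 16, d ∣ 16 → 16 % 5 = d % 5 → d = 1 ∨ d = 16 := by decide
      exact h1 d (Nat.le_of_dvd (by norm_num) hd) hd hm
    exact ⟨a, hAH ha, hAq a ha, ha1, hn⟩

end Dichotomy

theorem IsSolvableAffine.exists_rigid {V : Type*} [AddCommGroup V] [Finite V]
    {G : Subgroup (Equiv.Perm V)} (hG : IsSolvableAffine G) {p : ℕ} (hp : p.Prime)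
    (hpV : ∀ v : V, p • v = 0) (h9 : 9 < Nat.card V) :
    ∃ Δ : Set V, 2 * Δ.ncard ≠ Nat.card V ∧ ∀ g ∈ G, (∀ x, g x ∈ Δ ↔ x ∈ Δ) → g = 1 := by
  have := Fact.mk hp
  let _ : Module (ZMod p) V := AddCommGroup.zmodModule hpV
  have hc : Nat.card V = p ^ Module.finrank (ZMod p) V := natCard_eq_pow_finrank_zmod p
  have h2 : ∀ n : ℕ, Nat.card V = 2 ^ n → ∀ v : V, v + v = 0 := by
    intro n hn v
    have hp2 : p = 2 := by
      refine (Nat.prime_dvd_prime_iff_eq hp Nat.prime_two).1 (hp.dvd_of_dvd_pow (n := n) ?_)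
      rw [← hn, hc]
      refine dvd_pow_self p fun h0 => ?_
      rw [h0, pow_zero] at hc
      omega
    rw [← two_nsmul, ← hp2, hpV]
  by_cases h16 : Nat.card V = 16
  · have h2 := h2 4 h16
    rcases (hG.isSolvableLinear h2).exists_quintic_or_preservesDecomposition h16 with
      ⟨x, hx, hx5, hx1, hn⟩ | ⟨U, U', hU, hU', hUU', hH⟩
    · exact hG.exists_rigid_of_quintic h2 h16 hx.2 hx5 hx1 hn
    · exact hG.exists_rigid_of_decomposition h16 hU hU' hUU' hH
  by_cases h32 : Nat.card V = 32
  · exact hG.exists_rigid_of_card_eq_thirtyTwo (h2 5 h32) h32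
  obtain ⟨Δ, -, hΔ, hrig⟩ := hasRigidSubset_of_module p h9 h16 h32
  refine ⟨Δ, ?_, fun g hg h => hrig g (hG.isAffine g hg) fun x => ?_⟩
  · rw [Set.ncard_coe_finset]
    omega
  · simpa using h x

/-- Theorem 3.1: a primitive solvable permutation group of degree > 9 has a regular orbit
on the power set, witnessed by a set `Δ` with `|Δ| ≠ |Ω|/2`. -/
theorem stmt_2 {Ω : Type*} [Fintype Ω] (G : Subgroup (Equiv.Perm Ω))
    (hsolv : IsSolvable G) (hprim : IsPrimitivePermGroup Ω G)
    (hcard : 9 < Fintype.card Ω) :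
    ∃ Δ : Set Ω, 2 * Δ.ncard ≠ Fintype.card Ω ∧ MulAction.stabilizer G Δ = ⊥ := by
  have : Group.IsSolvable G := hsolv
  have := hprim.1
  have : MulAction.IsPreprimitive G Ω := { isTrivialBlock_of_isBlock := fun {B} hB => hprim.2 B hB }
  have : Nontrivial Ω := Fintype.one_lt_card_iff_nontrivial.1 (by omega)
  obtain ⟨p, hp, V, _, e, hpV, haff, htr⟩ := exists_affine_structure G
  have : Finite V := Finite.of_equiv Ω e.symm
  have hcardV : Nat.card V = Fintype.card Ω := by
    rw [Nat.card_congr e, Nat.card_eq_fintype_card]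
  obtain ⟨Δ, hΔ, hrig⟩ := (isSolvableAffine_map G e haff htr).exists_rigid hp hpV (by rwa [hcardV])
  refine ⟨e '' Δ, ?_, ?_⟩
  · rwa [Set.ncard_image_of_injective _ e.injective, ← hcardV]
  · rw [Subgroup.eq_bot_iff_forall]
    intro g hg
    have hgΔ : ∀ y, (g : Equiv.Perm Ω) y ∈ e '' Δ ↔ y ∈ e '' Δ := fun y => by
      have h1 := Set.smul_mem_smul_set_iff (a := g) (s := e '' Δ) (x := y)
      rw [MulAction.mem_stabilizer_iff.1 hg] at h1
      exact h1
    have h2 : e.symm.permCongr (g : Equiv.Perm Ω) = 1 := by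
      refine hrig _ ⟨g, g.2, rfl⟩ fun x => ?_
      have h3 := hgΔ (e x)
      rw [e.injective.mem_set_image, Set.mem_image_equiv] at h3
      exact h3
    refine Subtype.ext (Equiv.ext fun y => ?_)
    have h4 := Equiv.congr_fun h2 (e.symm y)
    simpa using h4
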